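/- Let F be a finitely generated free group and let H be a group generated as a monoid by a finite set X. If the word problem of H with respect to X is accepted by some (not necessarily deterministic) F-automaton over X, then it is accepted by a deterministic F-automaton over X. -/

import Mathlib

/-- A monoid `M` has *unique left inverses* if whenever `b * a = 1 = c * a` we have `b = c`. -/
def UniqueLeftInverses (M : Type) [Monoid M] : Prop :=
  ∀ a b c : M, b * a = 1 → c * a = 1 → b = c

/-- The word problem of a group `H`, generated as a monoid by the image of `φ : X → H`,
is the set of words over `X` representing the identity of `H`. -/
def wordProblem {H : Type} [Group H] {X : Type} (φ : X → H) : Set (List X) :=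
  {w | (w.map φ).prod = 1}

/-- A deterministic `M`-automaton over the alphabet `X`: a finite directed graph with
a distinguished initial state, a set of terminal states, and edges labelled by pairs in
`M × X`, such that each state has at most one outgoing edge per letter of `X`. -/
structure DetMAutomaton (M : Type) [Monoid M] (X : Type) where
  State : Type
  [stateFintype : Fintype State]
  init : State
  terminal : Set State
  edge : State → M × X → State → Prop
  det : ∀ ⦃p : State⦄ ⦃x : X⦄ ⦃g h : M⦄ ⦃q r : State⦄,
      edge p (g, x) q → edge p (h, x) r → g = h ∧ q = r

namespace DetMAutomaton

variable {M : Type} [Monoid M] {X : Type}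

/-- `A.Path p m w q` means there is a path from `p` to `q` labelled `(m, w)`: the
`X`-components of its edge labels spell out `w` in order, and the `M`-components
multiply in order to `m`. -/
inductive Path (A : DetMAutomaton M X) : A.State → M → List X → A.State → Prop
  | nil (p : A.State) : Path A p 1 [] p
  | cons {p q r : A.State} {g h : M} {x : X} {w : List X} :
      A.edge p (g, x) q → Path A q h w r → Path A p (g * h) (x :: w) r

/-- The language accepted by a deterministic `M`-automaton: all words `w` such that some
path labelled `(1, w)` leads from the initial state to a terminal state. -/
def Lang (A : DetMAutomaton M X) : Set (List X) :=
  {w | ∃ q ∈ A.terminal, A.Path A.init 1 w q}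

/-- A deterministic `M`-automaton is *deterministic terminal state minimal* (DTSM) if no
deterministic `M`-automaton accepting the same language has strictly fewer terminal states. -/
def DTSM (A : DetMAutomaton M X) : Prop :=
  ∀ B : DetMAutomaton M X, B.Lang = A.Lang → Nat.card A.terminal ≤ Nat.card B.terminal

end DetMAutomaton

/-- A (nondeterministic) `M`-automaton over the alphabet `X`: a finite directed graph with
a distinguished initial state, a set of terminal states, and finitely many edges labelled by
pairs in `M × X*`. -/
structure MAutomaton (M : Type) [Monoid M] (X : Type) where
  State : Type
  [stateFintype : Fintype State]
  init : State
  terminal : Set State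
  edge : State → M × List X → State → Prop
  edgeFinite : {e : State × (M × List X) × State | edge e.1 e.2.1 e.2.2}.Finite

namespace MAutomaton

variable {M : Type} [Monoid M] {X : Type}

/-- `A.Path p m w q` means there is a path from `p` to `q` labelled `(m, w)`: the
concatenation in order of the `X*`-components of its edge labels is `w`, and the
`M`-components multiply in order to `m`. -/
inductive Path (A : MAutomaton M X) : A.State → M → List X → A.State → Prop
  | nil (p : A.State) : Path A p 1 [] p
  | cons {p q r : A.State} {g h : M} {u w : List X} :
      A.edge p (g, u) q → Path A q h w r → Path A p (g * h) (u ++ w) r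

/-- The language accepted by an `M`-automaton: all words `w` such that some path labelled
`(1, w)` leads from the initial state to a terminal state. -/
def Lang (A : MAutomaton M X) : Set (List X) :=
  {w | ∃ q ∈ A.terminal, A.Path A.init 1 w q}

/-- An `M`-automaton is *terminal state minimal* (TSM) if no `M`-automaton accepting the
same language has strictly fewer terminal states. -/
def TSM (A : MAutomaton M X) : Prop :=
  ∀ B : MAutomaton M X, B.Lang = A.Lang → Nat.card A.terminal ≤ Nat.card B.terminal

end MAutomaton

namespace FreeGroup

variable {α : Type*}

theorem finite_of_fg (h : Group.FG (FreeGroup α)) : Finite α := by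
  classical
  obtain ⟨S, hS⟩ := h
  have h₁ : Finite (FreeGroup α →* Multiplicative (ZMod 2)) :=
    Finite.of_injective (fun f (s : S) => f s) fun f g hfg => by
      refine MonoidHom.eq_of_eqOn_dense hS fun s hs => ?_
      exact congrFun hfg ⟨s, hs⟩
  have h₂ : Finite (α → Multiplicative (ZMod 2)) := Finite.of_equiv _ lift.symm
  refine Finite.of_injective
    (fun (a : α) => (Pi.mulSingle a (Multiplicative.ofAdd 1) : α → Multiplicative (ZMod 2))) ?_
  intro a b hab
  by_contra hne
  have := congrFun hab a
  simp only [Pi.mulSingle_eq_same, Pi.mulSingle_eq_of_ne hne] at this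
  exact absurd this (by decide)

theorem finite_setOf_norm_le [Finite α] [DecidableEq α] (n : ℕ) :
    {x : FreeGroup α | x.norm ≤ n}.Finite := by
  refine ((List.finite_length_le (α × Bool) n).image mk).subset fun x hx => ?_
  exact ⟨x.toWord, hx, mk_toWord⟩

theorem prefix_toWord_mul_letter [DecidableEq α] {P : List (α × Bool)} {g : FreeGroup α}
    (h : P <+: g.toWord) (hl : P.length < g.toWord.length) (x : α × Bool) :
    P <+: (g * mk [x]).toWord ∧ g.toWord.length ≤ (g * mk [x]).toWord.length + 1 := by
  have hr : IsReduced g.toWord := isReduced_toWord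
  obtain ⟨W, l, hW⟩ : ∃ W l, g.toWord = W ++ [l] :=
    ⟨_, _, (List.dropLast_append_getLast (List.ne_nil_of_length_pos (by omega))).symm⟩
  have hg : g = mk (W ++ [l]) := by rw [← hW, mk_toWord]
  rw [hW] at hr h hl
  by_cases hx : l.1 = x.1 → l.2 = x.2
  · have h₁ : IsReduced (W ++ [l] ++ [x]) := by
      have := hr.append_overlap (L₁ := W) (L₂ := [l]) (L₃ := [x])
      exact this (by simpa [isReduced_cons_cons] using hx) (by simp)
    have h₂ : (g * mk [x]).toWord = W ++ [l] ++ [x] := by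
      rw [hg, mul_mk, toWord_mk, h₁.reduce_eq]
    rw [h₂, hW]
    exact ⟨h.trans (List.prefix_append _ _), by simp⟩
  · have h₁ : IsReduced W := (List.isChain_append.1 hr).1
    have h₂ : (g * mk [x]).toWord = W := by
      have hl' : l = (x.1, !x.2) := by
        push Not at hx
        ext
        · exact hx.1
        · exact Bool.eq_not.2 hx.2
      rw [hg, mul_mk, hl', List.append_assoc, ← mul_mk]
      have : (mk ([(x.1, !x.2)] ++ [x]) : FreeGroup α) = 1 := by
        refine Quot.sound ?_
        exact Red.Step.not_rev (L₁ := []) (L₂ := [])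
      rw [this, mul_one, toWord_mk, h₁.reduce_eq]
    rw [h₂, hW]
    refine ⟨?_, by simp⟩
    rcases List.prefix_concat_iff.1 h with h | h
    · subst h
      simp at hl
    · exact h

theorem prefix_toWord_mul_mk [DecidableEq α] {P : List (α × Bool)} (s : List (α × Bool)) :
    ∀ {g : FreeGroup α}, P <+: g.toWord → P.length + s.length ≤ g.toWord.length →
      P <+: (g * mk s).toWord := by
  induction s with
  | nil => 
    intro g h _
    rwa [← one_eq_mk, mul_one]
  | cons x s ih =>
    intro g h hl
    rw [List.length_cons] at hl
    obtain ⟨h₁, h₂⟩ := prefix_toWord_mul_letter h (by omega) x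
    have := ih h₁ (by omega)
    rwa [mul_assoc, mul_mk] at this

/-- An element that leaves the cone of reduced words with a given initial part in one step is close
to the tip of that cone. -/
theorem norm_inv_mul_le [DecidableEq α] {y g s : FreeGroup α} (h : ¬ y.toWord <+: g.toWord)
    (hs : y.toWord <+: (g * s).toWord) : (y⁻¹ * (g * s)).norm ≤ s.norm := by
  by_contra! hlt
  obtain ⟨C, hC⟩ := hs
  have hC' : y⁻¹ * (g * s) = mk C := by
    rw [inv_mul_eq_iff_eq_mul, ← mk_toWord (x := g * s), ← hC, ← mul_mk, mk_toWord]
  have h₁ : s.norm ≤ C.length := by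
    rw [hC'] at hlt
    exact hlt.le.trans norm_mk_le
  apply h
  have := prefix_toWord_mul_mk (P := y.toWord) s⁻¹.toWord (g := g * s) ⟨C, hC⟩ (by
    rw [← hC, List.length_append]
    have : s⁻¹.toWord.length = s.norm := norm_inv_eq
    omega)
  rwa [mk_toWord, mul_inv_cancel_right] at this

theorem exists_median [DecidableEq α] (f g : FreeGroup α) : ∃ v : FreeGroup α,
    v.toWord <+: f.toWord ∧ (f⁻¹ * v).toWord <+: (f⁻¹ * g).toWord ∧
      (g⁻¹ * v).toWord <+: (g⁻¹).toWord := by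
  have key : ∀ L M : List (α × Bool), ∃ V A B, L = V ++ A ∧ M = V ++ B ∧
      ∀ a ∈ A.head?, ∀ b ∈ B.head?, a ≠ b := by
    intro L
    induction L with
    | nil => exact fun M => ⟨[], [], M, by simp⟩
    | cons x L ih =>
      intro M
      rcases M with _ | ⟨y, M⟩
      · exact ⟨[], x :: L, [], by simp⟩
      · by_cases hxy : x = y
        · obtain ⟨V, A, B, h₁, h₂, h₃⟩ := ih M
          exact ⟨x :: V, A, B, by simp [h₁], by simp [h₂, hxy], h₃⟩
        · exact ⟨[], x :: L, y :: M, by simpa using hxy⟩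
  obtain ⟨V, A, B, h₁, h₂, h₃⟩ := key f.toWord g.toWord
  have hf : IsReduced (V ++ A) := h₁ ▸ isReduced_toWord
  have hg : IsReduced (V ++ B) := h₂ ▸ isReduced_toWord
  have hV : IsReduced V := (List.isChain_append.1 hf).1
  have hA : IsReduced A := (List.isChain_append.1 hf).2.1
  have hB : IsReduced B := (List.isChain_append.1 hg).2.1
  have hA' : IsReduced (invRev A) := by
    rw [isReduced_iff_reduce_eq, reduce_invRev, hA.reduce_eq]
  have hBi : IsReduced (invRev B) := by
    rw [isReduced_iff_reduce_eq, reduce_invRev, hB.reduce_eq]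
  have hAB : IsReduced (invRev A ++ B) := by
    refine List.IsChain.append hA' hB ?_
    intro x hx y hy hxy
    rw [invRev, List.getLast?_reverse, List.head?_map] at hx
    obtain ⟨a, ha, rfl⟩ := Option.map_eq_some_iff.1 hx
    have := h₃ a ha y hy
    by_contra hne
    apply this
    ext
    · exact hxy
    · simpa using hne
  have ef : f = mk V * mk A := by rw [mul_mk, ← h₁, mk_toWord]
  have eg : g = mk V * mk B := by rw [mul_mk, ← h₂, mk_toWord]
  refine ⟨mk V, ?_, ?_, ?_⟩
  · rw [h₁, toWord_mk, hV.reduce_eq]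
    exact List.prefix_append _ _
  · have e₁ : f⁻¹ * mk V = mk (invRev A) := by rw [ef, ← inv_mk]; group
    have e₂ : f⁻¹ * g = mk (invRev A ++ B) := by rw [ef, eg, ← mul_mk, ← inv_mk]; group
    rw [e₁, e₂, toWord_mk, toWord_mk, hA'.reduce_eq, hAB.reduce_eq]
    exact List.prefix_append _ _
  · have e₁ : g⁻¹ * mk V = mk (invRev B) := by rw [eg, ← inv_mk]; group
    rw [e₁, toWord_mk, hBi.reduce_eq, toWord_inv, h₂, invRev_append]
    exact List.prefix_append _ _

end FreeGroup

/-- A system of labelled paths between the elements of `Q` in which paths can be composed,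
and split along a factorisation of their word. -/
structure PathSystem {M X Q : Type} [Monoid M] (P : Q → M → List X → Q → Prop) : Prop where
  comp : ∀ {p q r g h u v}, P p g u q → P q h v r → P p (g * h) (u ++ v) r
  split : ∀ {p r g} (u v), P p g (u ++ v) r → ∃ q g₁ g₂, g₁ * g₂ = g ∧ P p g₁ u q ∧ P q g₂ v r

namespace MAutomaton

variable {M X : Type} [Monoid M]

/-- Paths of an automaton that read one letter at a time; a state is paired with the part of the
current edge label which has not yet been read. -/
inductive SlowPath (A : MAutomaton M X) :
    A.State × List X → M → List X → A.State × List X → Prop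
  | nil (s : A.State × List X) : SlowPath A s 1 [] s
  | jump {p q : A.State} {r : A.State × List X} {g h : M} {u w : List X} :
      A.edge p (g, u) q → SlowPath A (q, u) h w r → SlowPath A (p, []) (g * h) w r
  | read {q : A.State} {r : A.State × List X} {h : M} {x : X} {u w : List X} :
      SlowPath A (q, u) h w r → SlowPath A (q, x :: u) h (x :: w) r

variable {A : MAutomaton M X}

theorem SlowPath.comp {p q r : A.State × List X} {g h : M} {u v : List X}
    (h₁ : A.SlowPath p g u q) (h₂ : A.SlowPath q h v r) : A.SlowPath p (g * h) (u ++ v) r := by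
  induction h₁ with
  | nil => simpa using h₂
  | jump e _ ih => rw [mul_assoc]; exact .jump e (ih h₂)
  | read _ ih => exact .read (ih h₂)

theorem SlowPath.read_all (q : A.State) (u : List X) : A.SlowPath (q, u) 1 u (q, []) := by
  induction u with
  | nil => exact .nil _
  | cons x u ih => exact .read ih

theorem slowPath_of_path {p q : A.State} {g : M} {w : List X} (h : A.Path p g w q) :
    A.SlowPath (p, []) g w (q, []) := by
  induction h with
  | nil => exact .nil _
  | @cons p q r g h u w e _ ih =>
    refine .jump e ?_
    simpa using (SlowPath.read_all q u).comp ih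

theorem SlowPath.exists_path {s t : A.State × List X} {g : M} {w : List X}
    (h : A.SlowPath s g w t) (ht : t.2 = []) : ∃ v, w = s.2 ++ v ∧ A.Path s.1 g v t.1 := by
  induction h with
  | nil s => exact ⟨[], by simp [ht], .nil _⟩
  | jump e _ ih =>
    obtain ⟨v, rfl, hv⟩ := ih ht
    exact ⟨_, rfl, .cons e hv⟩
  | read _ ih =>
    obtain ⟨v, rfl, hv⟩ := ih ht
    exact ⟨v, rfl, hv⟩

variable (A) in
/-- The states of the slow automaton whose pending word is a suffix of an edge label. -/
def slowStates : Set (A.State × List X) :=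
  {s | s.2 = [] ∨ ∃ p g u q, A.edge p (g, u) q ∧ s.2 <:+ u}

theorem finite_slowStates : A.slowStates.Finite := by
  have := A.stateFintype
  have h₁ : {l : List X | ∃ p g u q, A.edge p (g, u) q ∧ l <:+ u}.Finite := by
    refine (A.edgeFinite.biUnion (t := fun e => {l | l ∈ e.2.1.2.tails}) fun e _ =>
      List.finite_toSet _).subset ?_
    rintro l ⟨p, g, u, q, e, h⟩
    exact Set.mem_biUnion (x := (p, (g, u), q)) e ((List.mem_tails _ _).2 h)
  refine (Set.finite_univ.prod (h₁.insert [])).subset ?_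
  rintro ⟨p, l⟩ h
  exact ⟨trivial, h⟩

theorem mem_slowStates_of_edge {p q : A.State} {g : M} {u : List X} (h : A.edge p (g, u) q) :
    (q, u) ∈ A.slowStates :=
  Or.inr ⟨_, _, _, _, h, List.suffix_rfl⟩

theorem mem_slowStates_of_cons {q : A.State} {x : X} {u : List X}
    (h : (q, x :: u) ∈ A.slowStates) : (q, u) ∈ A.slowStates := by
  rcases h with h | ⟨p, g, v, r, e, h⟩
  · simp at h
  · exact Or.inr ⟨p, g, v, r, e, (List.suffix_cons x u).trans h⟩

theorem SlowPath.split {s t : A.State × List X} {g : M} {w : List X} (h : A.SlowPath s g w t)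
    (hs : s ∈ A.slowStates) : ∀ u v, w = u ++ v → ∃ q ∈ A.slowStates, ∃ g₁ g₂, g₁ * g₂ = g ∧
      A.SlowPath s g₁ u q ∧ A.SlowPath q g₂ v t := by
  induction h with
  | nil s =>
    intro u v h
    obtain ⟨rfl, rfl⟩ := List.append_eq_nil_iff.1 h.symm
    exact ⟨s, hs, 1, 1, by simp, .nil _, .nil _⟩
  | jump e _ ih =>
    intro u v h
    obtain ⟨q, hq, g₁, g₂, rfl, h₁, h₂⟩ := ih (mem_slowStates_of_edge e) u v h
    exact ⟨q, hq, _, g₂, mul_assoc _ _ _, .jump e h₁, h₂⟩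
  | read h' ih =>
    intro u v h
    rcases u with _ | ⟨y, u⟩
    · exact ⟨_, hs, 1, _, one_mul _, .nil _, by rw [List.nil_append] at h; rw [← h]; exact .read h'⟩
    · rw [List.cons_append, List.cons_eq_cons] at h
      obtain ⟨rfl, h⟩ := h
      obtain ⟨q, hq, g₁, g₂, rfl, h₁, h₂⟩ := ih (mem_slowStates_of_cons hs) u v h
      exact ⟨q, hq, g₁, g₂, rfl, .read h₁, h₂⟩

theorem SlowPath.exists_first_passage {α : Type} [DecidableEq α] {A : MAutomaton (FreeGroup α) X}
    {L : ℕ} (hL : ∀ p g u q, A.edge p (g, u) q → g.norm ≤ L) {y : FreeGroup α}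
    {s t : A.State × List X} {g : FreeGroup α} {w : List X} (h : A.SlowPath s g w t)
    (hs : s ∈ A.slowStates) : ∀ x : FreeGroup α, ¬ y.toWord <+: x.toWord →
      y.toWord <+: (x * g).toWord → ∃ q ∈ A.slowStates, ∃ g₁ g₂ u v, g₁ * g₂ = g ∧ u ++ v = w ∧
        A.SlowPath s g₁ u q ∧ A.SlowPath q g₂ v t ∧ (y⁻¹ * (x * g₁)).norm ≤ L := by
  induction h with
  | nil s =>
    intro x h₁ h₂
    rw [mul_one] at h₂
    exact absurd h₂ h₁
  | @jump p q r g h u w e h' ih =>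
    intro x h₁ h₂
    by_cases hx : y.toWord <+: (x * g).toWord
    · refine ⟨(q, u), mem_slowStates_of_edge e, g, h, [], w, rfl, rfl, ?_, h',
        (FreeGroup.norm_inv_mul_le h₁ hx).trans (hL _ _ _ _ e)⟩
      simpa using SlowPath.jump e (.nil (A := A) (q, u))
    · rw [← mul_assoc] at h₂
      obtain ⟨q, hq, g₁, g₂, u, v, rfl, rfl, h₃, h₄, h₅⟩ := ih (mem_slowStates_of_edge e) _ hx h₂
      exact ⟨q, hq, g * g₁, g₂, u, v, mul_assoc _ _ _, rfl, .jump e h₃, h₄,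
        by rwa [← mul_assoc x]⟩
  | read h' ih =>
    intro x h₁ h₂
    obtain ⟨q, hq, g₁, g₂, u, v, rfl, rfl, h₃, h₄, h₅⟩ := ih (mem_slowStates_of_cons hs) x h₁ h₂
    exact ⟨q, hq, g₁, g₂, _, v, rfl, rfl, .read h₃, h₄, h₅⟩

theorem exists_pathSystem {α : Type} [DecidableEq α] (A : MAutomaton (FreeGroup α) X) :
    ∃ (Q : Type) (_ : Finite Q) (P : Q → FreeGroup α → List X → Q → Prop) (i : Q) (T : Set Q)
      (L : ℕ), PathSystem P ∧ (∀ w, w ∈ A.Lang ↔ ∃ t ∈ T, P i 1 w t) ∧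
      ∀ {y p r g w}, P p g w r → y.toWord <+: g.toWord → ∃ q g₁ g₂ u v, g₁ * g₂ = g ∧ u ++ v = w ∧
        P p g₁ u q ∧ P q g₂ v r ∧ (y⁻¹ * g₁).norm ≤ L := by
  obtain ⟨L, hL⟩ : ∃ L, ∀ p g u q, A.edge p (g, u) q → g.norm ≤ L := by
    obtain ⟨L, hL⟩ := (A.edgeFinite.image fun e => e.2.1.1.norm).bddAbove
    exact ⟨L, fun p g u q e => hL ⟨(p, (g, u), q), e, rfl⟩⟩
  refine ⟨A.slowStates, finite_slowStates, fun p g w q => A.SlowPath p g w q,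
    ⟨(A.init, []), Or.inl rfl⟩, {s | s.1.2 = [] ∧ s.1.1 ∈ A.terminal}, L,
    ⟨fun h₁ h₂ => h₁.comp h₂, ?_⟩, fun w => ⟨?_, ?_⟩, ?_⟩
  · intro p r g u v h
    obtain ⟨q, hq, h⟩ := h.split p.2 u v rfl
    exact ⟨⟨q, hq⟩, h⟩
  · rintro ⟨q, hq, h⟩
    exact ⟨⟨(q, []), Or.inl rfl⟩, ⟨rfl, hq⟩, slowPath_of_path h⟩
  · rintro ⟨t, ⟨h₁, h₂⟩, h⟩
    obtain ⟨v, rfl, h⟩ := h.exists_path h₁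
    exact ⟨_, h₂, h⟩
  · intro y p r g w h hy
    by_cases hy' : y.toWord <+: (1 : FreeGroup α).toWord
    · have : y = 1 := by simpa using hy'
      subst this
      exact ⟨p, 1, g, [], w, one_mul _, rfl, .nil _, h, by simp⟩
    · obtain ⟨q, hq, g₁, g₂, u, v, h⟩ := h.exists_first_passage hL p.2 1 hy' (by rwa [one_mul])
      rw [one_mul] at h
      exact ⟨⟨q, hq⟩, g₁, g₂, u, v, h⟩

/-- Transport of an automaton along an isomorphism of the label group. -/
def mapLabel {N : Type} [Monoid N] (A : MAutomaton M X) (e : M ≃* N) : MAutomaton N X where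
  State := A.State
  stateFintype := A.stateFintype
  init := A.init
  terminal := A.terminal
  edge p l q := A.edge p (e.symm l.1, l.2) q
  edgeFinite := by
    refine (A.edgeFinite.image fun d => (d.1, (e d.2.1.1, d.2.1.2), d.2.2)).subset ?_
    rintro ⟨p, ⟨g, u⟩, q⟩ h
    exact ⟨(p, (e.symm g, u), q), h, by simp⟩

theorem path_mapLabel {N : Type} [Monoid N] {e : M ≃* N} {p q : A.State} {g : M} {w : List X}
    (h : A.Path p g w q) : (A.mapLabel e).Path p (e g) w q := by
  induction h with
  | nil p => rw [map_one]; exact .nil (A := A.mapLabel e) p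
  | cons h _ ih =>
    rw [map_mul]
    exact .cons (A := A.mapLabel e) (by simpa [mapLabel] using h) ih

theorem path_of_mapLabel {N : Type} [Monoid N] {e : M ≃* N} {p q : A.State} {g : N} {w : List X}
    (h : (A.mapLabel e).Path p g w q) : A.Path p (e.symm g) w q := by
  have key : ∀ {p q : (A.mapLabel e).State} {g : N} {w : List X},
      (A.mapLabel e).Path p g w q → A.Path p (e.symm g) w q := by
    intro p q g w h
    induction h with
    | nil p => rw [map_one]; exact .nil (A := A) p
    | cons h _ ih =>
      rw [map_mul]
      exact .cons (A := A) h ih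
  exact key h

theorem lang_mapLabel {N : Type} [Monoid N] (e : M ≃* N) : (A.mapLabel e).Lang = A.Lang := by
  ext w
  constructor
  · rintro ⟨q, hq, h⟩
    exact ⟨q, hq, map_one e.symm ▸ path_of_mapLabel h⟩
  · rintro ⟨q, hq, h⟩
    exact ⟨q, hq, map_one e ▸ path_mapLabel (e := e) h⟩

end MAutomaton

section WordProblem

variable {α H X : Type} [Group H] {φ : X → H}

/-- The element represented by a word. -/
abbrev wordVal (φ : X → H) (w : List X) : H := (w.map φ).prod

theorem wordVal_append (u v : List X) : wordVal φ (u ++ v) = wordVal φ u * wordVal φ v := by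
  simp [wordVal]

theorem wordVal_eq_of_replace {M Q : Type} [Monoid M] {P : Q → M → List X → Q → Prop}
    (hP : PathSystem P) {i : Q} {T : Set Q}
    (hT : ∀ w, wordVal φ w = 1 ↔ ∃ t ∈ T, P i 1 w t) {p q t : Q} {f g h : M}
    {u v v' w : List X} (ht : t ∈ T) (h₁ : P i f u p) (h₂ : P p g v q) (h₃ : P q h w t)
    (hfgh : f * g * h = 1) (h₄ : P p g v' q) : wordVal φ v' = wordVal φ v := by
  have e₁ := (hT _).2 ⟨t, ht, hfgh ▸ hP.comp (hP.comp h₁ h₂) h₃⟩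
  have e₂ := (hT _).2 ⟨t, ht, hfgh ▸ hP.comp (hP.comp h₁ h₄) h₃⟩
  simp only [wordVal_append] at e₁ e₂
  simpa using e₂.trans e₁.symm

/-- The geometric consequence of the word problem of `H` being accepted by an automaton with labels
in a free group: a point on one side of a triangle of which that side is geodesic is uniformly
close to one of the other two sides. -/
theorem exists_bottleneck [Finite α] (hgen : ∀ h : H, ∃ w, wordVal φ w = h)
    {A : MAutomaton (FreeGroup α) X} (hA : A.Lang = wordProblem φ) :
    ∃ R : ℕ, ∀ w₁ w₂ z, wordVal φ (w₁ ++ w₂ ++ z) = 1 →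
      (∀ u, wordVal φ u = wordVal φ (w₁ ++ w₂) → (w₁ ++ w₂).length ≤ u.length) →
      ∃ z₁ z₂ r, z = z₁ ++ z₂ ∧ r.length ≤ R ∧ wordVal φ r = wordVal φ (w₂ ++ z₁) := by
  classical
  obtain ⟨Q, _, P, i, T, L, hP, hT, hF⟩ := A.exists_pathSystem
  have hT' : ∀ w, wordVal φ w = 1 ↔ ∃ t ∈ T, P i 1 w t := fun w => by
    rw [← hT, hA]; rfl
  let useful : Q → FreeGroup α → List X → Q → Prop := fun p g v q =>
    P p g v q ∧ ∃ t ∈ T, ∃ f h u w, P i f u p ∧ P q h w t ∧ f * g * h = 1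
  have hfin : {x : H | ∃ p g v q, g.norm ≤ L + L ∧ useful p g v q ∧ wordVal φ v = x}.Finite := by
    have h₁ : ∀ d : Q × FreeGroup α × Q,
        {x : H | ∃ v, useful d.1 d.2.1 v d.2.2 ∧ wordVal φ v = x}.Finite := by
      intro d
      refine Set.Subsingleton.finite ?_
      rintro _ ⟨v, ⟨h₁, t, ht, f, h, u, w, h₂, h₃, h₄⟩, rfl⟩ _ ⟨v', ⟨h₅, -⟩, rfl⟩
      exact (wordVal_eq_of_replace hP hT' ht h₂ h₁ h₃ h₄ h₅).symm
    refine ((Set.finite_univ.prod ((FreeGroup.finite_setOf_norm_le (L + L)).prod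
      Set.finite_univ)).biUnion fun d _ => h₁ d).subset ?_
    rintro x ⟨p, g, v, q, hg, hv⟩
    exact Set.mem_biUnion (x := (p, g, q)) ⟨trivial, hg, trivial⟩ ⟨v, hv⟩
  choose wd hwd using hgen
  obtain ⟨ρ, hρ⟩ := (hfin.image fun x => (wd x).length).bddAbove
  refine ⟨ρ + ρ, fun w₁ w₂ z hz hgeo => ?_⟩
  obtain ⟨t, ht, hpath⟩ := (hT' _).1 hz
  obtain ⟨q, k, h, hkh, hk, hh⟩ := hP.split _ _ hpath
  obtain ⟨p, f, k', hfk, hf, hk'⟩ := hP.split _ _ hk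
  obtain ⟨v, hv₁, hv₂, hv₃⟩ := FreeGroup.exists_median f k
  rw [show f⁻¹ * k = k' by rw [← hfk]; group] at hv₂
  rw [show k⁻¹ = h from (eq_inv_of_mul_eq_one_right hkh).symm] at hv₃
  obtain ⟨s₁, f₁, f₂, u₁, u₂, rfl, rfl, p₁, p₂, n₁⟩ := hF hf hv₁
  obtain ⟨s₂, k₁, k₂, u₃, u₄, rfl, rfl, p₃, p₄, n₂⟩ := hF hk' hv₂
  obtain ⟨s₃, h₁, h₂, z₁, z₂, rfl, rfl, p₅, p₆, n₃⟩ := hF hh hv₃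
  subst hfk
  have hx₁ : wordVal φ (u₂ ++ u₃) ∈
      {x : H | ∃ p g v q, g.norm ≤ L + L ∧ useful p g v q ∧ wordVal φ v = x} := by
    refine ⟨s₁, f₂ * k₁, _, s₂, ?_, ⟨hP.comp p₂ p₃, t, ht, f₁, _, _, _, p₁,
      hP.comp p₄ (hP.comp p₅ p₆), by rw [← hkh]; group⟩, rfl⟩
    rw [show f₂ * k₁ = (v⁻¹ * f₁)⁻¹ * (((f₁ * f₂)⁻¹ * v)⁻¹ * k₁) by group]
    exact (FreeGroup.norm_mul_le _ _).trans (add_le_add (by rwa [FreeGroup.norm_inv_eq]) n₂)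
  have hx₂ : wordVal φ (u₄ ++ z₁) ∈
      {x : H | ∃ p g v q, g.norm ≤ L + L ∧ useful p g v q ∧ wordVal φ v = x} := by
    refine ⟨s₂, k₂ * h₁, _, s₃, ?_, ⟨hP.comp p₄ p₅, t, ht, _, h₂, _, _, hP.comp p₁
      (hP.comp p₂ p₃), p₆, by rw [← hkh]; group⟩, rfl⟩
    rw [show k₂ * h₁ = (((f₁ * f₂)⁻¹ * v)⁻¹ * k₁)⁻¹ * ((h₁ * h₂ * v)⁻¹ * h₁) by
      rw [eq_inv_of_mul_eq_one_right hkh]; group]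
    exact (FreeGroup.norm_mul_le _ _).trans (add_le_add (by rwa [FreeGroup.norm_inv_eq]) n₃)
  have hle₁ := hρ ⟨_, hx₁, rfl⟩
  have hle₂ := hρ ⟨_, hx₂, rfl⟩
  have hlen : (u₂ ++ u₃).length ≤ ρ := by
    have := hgeo (u₁ ++ wd (wordVal φ (u₂ ++ u₃)) ++ u₄) (by
      simp only [wordVal_append, hwd, mul_assoc])
    simp only [List.length_append] at this hle₁ ⊢
    omega
  refine ⟨z₁, z₂, u₃ ++ wd (wordVal φ (u₄ ++ z₁)), rfl, ?_, ?_⟩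
  · simp only [List.length_append] at hlen hle₂ ⊢
    omega
  · simp only [wordVal_append, hwd, mul_assoc]

theorem exists_lt_lt_of_finite {Q : Type*} [Finite Q] (s : ℕ → ℕ → Q) :
    ∃ n i j k, i < j ∧ j < k ∧ k ≤ n ∧ s n i = s n j ∧ s n j = s n k := by
  classical
  have := Fintype.ofFinite Q
  refine ⟨2 * Fintype.card Q, ?_⟩
  obtain ⟨q, -, hq⟩ := Finset.exists_lt_card_fiber_of_mul_lt_card_of_maps_to
    (s := Finset.range (2 * Fintype.card Q + 1)) (t := Finset.univ) (n := 2)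
    (f := s (2 * Fintype.card Q)) (fun _ _ => Finset.mem_univ _) (by simp; omega)
  let S := Finset.filter (fun x => s (2 * Fintype.card Q) x = q)
    (Finset.range (2 * Fintype.card Q + 1))
  have hm : ∀ a : Fin S.card, S.orderEmbOfFin rfl a < 2 * Fintype.card Q + 1 ∧
      s (2 * Fintype.card Q) (S.orderEmbOfFin rfl a) = q := fun a => by
    have h := S.orderEmbOfFin_mem rfl a
    rw [Finset.mem_filter, Finset.mem_range] at h
    exact h
  have hq' : 2 < S.card := hq
  refine ⟨S.orderEmbOfFin rfl ⟨0, by omega⟩, S.orderEmbOfFin rfl ⟨1, by omega⟩,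
    S.orderEmbOfFin rfl ⟨2, hq⟩, ?_, ?_, ?_, ?_, ?_⟩
  · simp
  · simp
  · exact Nat.lt_succ_iff.1 (hm _).1
  · rw [(hm _).2, (hm _).2]
  · rw [(hm _).2, (hm _).2]

/-- If the labels of the automaton commute then sequences in `H` contain two consecutive
increments that commute. -/
theorem exists_commute_of_comm {M : Type} [Monoid M] (hgen : ∀ h : H, ∃ w, wordVal φ w = h)
    {Q : Type} [Finite Q] {P : Q → M → List X → Q → Prop} {i : Q} {T : Set Q} (hP : PathSystem P)
    (hM : ∀ x y : M, x * y = y * x) (hT : ∀ w, wordVal φ w = 1 ↔ ∃ t ∈ T, P i 1 w t)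
    (c : ℕ → H) : ∃ i j k, i < j ∧ j < k ∧ Commute ((c i)⁻¹ * c j) ((c j)⁻¹ * c k) := by
  choose wd hwd using hgen
  have hW : ∀ n, ∃ W : List X, wordVal φ W = c n ∧ ∀ g q, P i g W q →
      ∃ (s : ℕ → Q) (E : ℕ → M), s n = q ∧ E n = g ∧
        (∀ a ≤ n, ∃ u, wordVal φ u = c a ∧ P i (E a) u (s a)) ∧
        ∀ a b, a < b → b ≤ n → ∃ u e, wordVal φ u = (c a)⁻¹ * c b ∧ P (s a) e u (s b) ∧
          E b = E a * e := by
    intro n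
    induction n with
    | zero =>
      refine ⟨wd (c 0), hwd _, fun g q h => ⟨fun _ => q, fun _ => g, rfl, rfl, ?_, ?_⟩⟩
      · rintro a ha
        obtain rfl := Nat.le_zero.1 ha
        exact ⟨_, hwd _, h⟩
      · intro a b hab hb
        omega
    | succ n ih =>
      obtain ⟨W, hW, ih⟩ := ih
      have hv : wordVal φ (W ++ wd ((c n)⁻¹ * c (n + 1))) = c (n + 1) := by
        rw [wordVal_append, hW, hwd, mul_inv_cancel_left]
      refine ⟨W ++ wd ((c n)⁻¹ * c (n + 1)), hv, fun g r h => ?_⟩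
      obtain ⟨q, g₁, g₂, rfl, h₁, h₂⟩ := hP.split _ _ h
      obtain ⟨s, E, rfl, rfl, h₃, h₄⟩ := ih _ _ h₁
      refine ⟨fun m => if m ≤ n then s m else r, fun m => if m ≤ n then E m else E n * g₂,
        by simp, by simp, ?_, ?_⟩
      · intro a ha
        by_cases han : a ≤ n
        · simpa [han] using h₃ a han
        · obtain rfl : a = n + 1 := by omega
          exact ⟨_, hv, by simpa using h⟩
      · intro a b hab hb
        have han : a ≤ n := by omega
        by_cases hbn : b ≤ n
        · simpa [han, hbn] using h₄ a b hab hbn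
        · obtain rfl : b = n + 1 := by omega
          rcases han.lt_or_eq with hlt | rfl
          · obtain ⟨u, e, h₅, h₆, h₇⟩ := h₄ a n hlt le_rfl
            refine ⟨u ++ wd ((c n)⁻¹ * c (n + 1)), e * g₂, ?_, ?_, ?_⟩
            · rw [wordVal_append, h₅, hwd]; group
            · simpa [han] using hP.comp h₆ h₂
            · simp [han, h₇, mul_assoc]
          · exact ⟨_, g₂, hwd _, by simpa using h₂, by simp⟩
  have hN : ∀ n, ∃ (s : ℕ → Q) (E : ℕ → M) (t : Q) (r : M) (w : List X), t ∈ T ∧ E n * r = 1 ∧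
      P (s n) r w t ∧ (∀ a ≤ n, ∃ u, wordVal φ u = c a ∧ P i (E a) u (s a)) ∧
        ∀ a b, a < b → b ≤ n → ∃ u e, wordVal φ u = (c a)⁻¹ * c b ∧ P (s a) e u (s b) ∧
          E b = E a * e := by
    intro n
    obtain ⟨W, hW, hs⟩ := hW n
    obtain ⟨t, ht, hp⟩ := (hT (W ++ wd (c n)⁻¹)).1 (by rw [wordVal_append, hW, hwd, mul_inv_cancel])
    obtain ⟨q, g, r, hgr, h₁, h₂⟩ := hP.split _ _ hp
    obtain ⟨s, E, rfl, rfl, h₃, h₄⟩ := hs _ _ h₁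
    exact ⟨s, E, t, r, _, ht, hgr, h₂, h₃, h₄⟩
  choose s E t r w ht hr hw h₁ h₂ using hN
  obtain ⟨n, a, b, d, hab, hbd, hdn, e₁, e₂⟩ := exists_lt_lt_of_finite s
  refine ⟨a, b, d, hab, hbd, ?_⟩
  obtain ⟨u, hu, pu⟩ := h₁ n a (by omega)
  obtain ⟨u₁, g₁, hu₁, pu₁, hg₁⟩ := h₂ n a b hab (by omega)
  obtain ⟨u₂, g₂, hu₂, pu₂, hg₂⟩ := h₂ n b d hbd hdn
  obtain ⟨u₃, g₃, pu₃, hg₃⟩ : ∃ u₃ g₃, P (s n d) g₃ u₃ (t n) ∧ E n d * g₃ = 1 := by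
    rcases hdn.lt_or_eq with hlt | rfl
    · obtain ⟨v, g, hv, pv, hg⟩ := h₂ n d n hlt le_rfl
      exact ⟨_, _, hP.comp pv (hw n), by rw [← mul_assoc, ← hg, hr]⟩
    · exact ⟨_, _, hw d, hr d⟩
  rw [hg₂, hg₁] at hg₃
  rw [← e₁] at pu₁
  rw [← e₂, ← e₁] at pu₂ pu₃
  have := wordVal_eq_of_replace hP hT (ht n) pu (hP.comp pu₁ pu₂) pu₃ (by rwa [← mul_assoc])
    (hM g₂ g₁ ▸ hP.comp pu₂ pu₁)
  rw [wordVal_append, wordVal_append, hu₁, hu₂] at this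
  exact this.symm

theorem finite_of_subsingleton {M : Type} [Monoid M] [Subsingleton M]
    (hgen : ∀ h : H, ∃ w, wordVal φ w = h)
    {Q : Type} [Finite Q] {P : Q → M → List X → Q → Prop} {i : Q} {T : Set Q} (hP : PathSystem P)
    (hT : ∀ w, wordVal φ w = 1 ↔ ∃ t ∈ T, P i 1 w t) : Finite H := by
  choose wd hwd using hgen
  have hex : ∀ h : H, ∃ q t g, t ∈ T ∧ P i 1 (wd h) q ∧ P q g (wd h⁻¹) t := by
    intro h
    obtain ⟨t, ht, hp⟩ := (hT (wd h ++ wd h⁻¹)).1 (by rw [wordVal_append, hwd, hwd, mul_inv_cancel])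
    obtain ⟨q, g₁, g₂, -, h₁, h₂⟩ := hP.split _ _ hp
    exact ⟨q, t, g₂, ht, Subsingleton.elim g₁ 1 ▸ h₁, h₂⟩
  choose q t g ht h₁ h₂ using hex
  refine Finite.of_injective q fun a b hab => ?_
  have := (hT _).2 ⟨t a, ht a, Subsingleton.elim (1 * g a) (1 : M) ▸
    hP.comp (h₁ b) (hab ▸ h₂ a)⟩
  rw [wordVal_append, hwd, hwd, mul_inv_eq_one] at this
  exact this.symm

end WordProblem

section PointwiseCuts

open scoped Pointwise

namespace SimpleGraph

variable {V : Type*} (G : SimpleGraph V)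

/-- The edges leaving a set of vertices, as ordered pairs pointing out of the set. -/
def cutEdges (C : Set V) : Set (V × V) :=
  {d | G.Adj d.1 d.2 ∧ d.1 ∈ C ∧ d.2 ∉ C}

/-- A set of vertices that cannot be split into two nonempty parts without an edge between. -/
def ConnectedSet (C : Set V) : Prop :=
  ∀ A ⊆ C, A.Nonempty → A ≠ C → ∃ u ∈ A, ∃ v ∈ C \ A, G.Adj u v

variable {G}

theorem ConnectedSet.exists_adj {C A : Set V} (hC : G.ConnectedSet C) (h₁ : (C ∩ A).Nonempty)
    (h₂ : (C ∩ Aᶜ).Nonempty) : ∃ u ∈ C ∩ A, ∃ v ∈ C ∩ Aᶜ, G.Adj u v := by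
  obtain ⟨u, hu, v, hv, h⟩ := hC (C ∩ A) Set.inter_subset_left h₁ (by
    obtain ⟨x, hx, hx'⟩ := h₂
    intro h
    rw [← h] at hx
    exact hx' hx.2)
  exact ⟨u, hu, v, ⟨hv.1, fun h => hv.2 ⟨hv.1, h⟩⟩, h⟩

theorem mem_cutEdges {C : Set V} {d : V × V} :
    d ∈ G.cutEdges C ↔ G.Adj d.1 d.2 ∧ d.1 ∈ C ∧ d.2 ∉ C := Iff.rfl

theorem cutEdges_compl (C : Set V) : G.cutEdges Cᶜ = Prod.swap '' G.cutEdges C := by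
  ext ⟨a, b⟩
  simp only [mem_cutEdges, Set.mem_compl_iff, not_not, Set.mem_image, Prod.exists, Prod.swap_prod_mk,
    Prod.mk.injEq]
  constructor
  · rintro ⟨h, ha, hb⟩
    exact ⟨b, a, ⟨h.symm, hb, ha⟩, rfl, rfl⟩
  · rintro ⟨c, d, ⟨h, hc, hd⟩, rfl, rfl⟩
    exact ⟨h.symm, hd, hc⟩

theorem ncard_cutEdges_compl (C : Set V) : (G.cutEdges Cᶜ).ncard = (G.cutEdges C).ncard := by
  rw [cutEdges_compl, Set.ncard_image_of_injective _ Prod.swap_injective]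

theorem finite_cutEdges_compl {C : Set V} : (G.cutEdges Cᶜ).Finite ↔ (G.cutEdges C).Finite := by
  rw [cutEdges_compl, Set.finite_image_iff Prod.swap_injective.injOn]

theorem cutEdges_nonempty (hG : G.Preconnected) {C : Set V} (h₁ : C.Nonempty)
    (h₂ : Cᶜ.Nonempty) : (G.cutEdges C).Nonempty := by
  obtain ⟨a, ha⟩ := h₁
  obtain ⟨b, hb⟩ := h₂
  obtain ⟨p⟩ := hG a b
  obtain ⟨d, -, h₁, h₂⟩ := p.exists_boundary_dart C ha hb
  exact ⟨(d.fst, d.snd), d.adj, h₁, h₂⟩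

theorem finite_cutEdges_corners {C D : Set V} (hC : (G.cutEdges C).Finite)
    (hD : (G.cutEdges D).Finite) :
    (G.cutEdges (C ∩ D)).Finite ∧ (G.cutEdges (Cᶜ ∩ Dᶜ)).Finite := by
  refine ⟨(hC.union hD).subset ?_, ?_⟩
  · rintro d ⟨h, h₁, h₂⟩
    by_cases h₃ : d.2 ∈ C
    · exact Or.inr ⟨h, h₁.2, fun h' => h₂ ⟨h₃, h'⟩⟩
    · exact Or.inl ⟨h, h₁.1, h₃⟩
  · refine ((finite_cutEdges_compl.2 hC).union (finite_cutEdges_compl.2 hD)).subset ?_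
    rintro d ⟨h, h₁, h₂⟩
    by_cases h₃ : d.2 ∈ Cᶜ
    · exact Or.inr ⟨h, h₁.2, fun h' => h₂ ⟨h₃, h'⟩⟩
    · exact Or.inl ⟨h, h₁.1, h₃⟩

theorem ncard_cutEdges_corners_le {C D : Set V} (hC : (G.cutEdges C).Finite)
    (hD : (G.cutEdges D).Finite) :
    (G.cutEdges (C ∩ D)).ncard + (G.cutEdges (Cᶜ ∩ Dᶜ)).ncard ≤
      (G.cutEdges C).ncard + (G.cutEdges D).ncard := by
  have hf := finite_cutEdges_corners hC hD
  rw [← Set.compl_union] at hf ⊢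
  rw [finite_cutEdges_compl] at hf
  rw [ncard_cutEdges_compl, ← Set.ncard_union_add_ncard_inter _ _ hf.1 hf.2,
    ← Set.ncard_union_add_ncard_inter _ _ hC hD]
  refine add_le_add (Set.ncard_le_ncard ?_ (hC.union hD))
    (Set.ncard_le_ncard ?_ (hC.inter_of_left _))
  · rintro d (⟨h, h₁, h₂⟩ | ⟨h, h₁, h₂⟩)
    · by_cases h₃ : d.2 ∈ C
      · exact Or.inr ⟨h, h₁.2, fun h' => h₂ ⟨h₃, h'⟩⟩
      · exact Or.inl ⟨h, h₁.1, h₃⟩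
    · rcases h₁ with h₁ | h₁
      · exact Or.inl ⟨h, h₁, fun h' => h₂ (Or.inl h')⟩
      · exact Or.inr ⟨h, h₁, fun h' => h₂ (Or.inr h')⟩
  · rintro d ⟨⟨h, h₁, h₂⟩, ⟨-, h₃, h₄⟩⟩
    exact ⟨⟨h, h₁.1, fun h' => h₄ (Or.inl h')⟩, ⟨h, h₁.2, fun h' => h₄ (Or.inr h')⟩⟩

theorem ConnectedSet.eq_reachable {C : Set V} {u v : V} (hC : G.ConnectedSet C)
    (hC' : G.ConnectedSet Cᶜ) (hu : u ∈ C) (hv : v ∉ C) (h : ¬ G.Reachable u v) :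
    C = {w | G.Reachable u w} := by
  have key : ∀ {D : Set V} {x : V}, G.ConnectedSet D → x ∈ D → D ⊆ {w | G.Reachable x w} := by
    intro D x hD hx
    by_contra hne
    rw [Set.not_subset] at hne
    obtain ⟨y, hy, hy'⟩ := hne
    obtain ⟨a, ha, b, hb, hab⟩ := hD.exists_adj (A := {w | G.Reachable x w})
      ⟨x, hx, Reachable.refl x⟩ ⟨y, hy, hy'⟩
    exact hb.2 (ha.2.trans hab.reachable)
  refine Set.Subset.antisymm (key hC hu) ?_
  intro w hw
  by_contra hwC
  exact h (hw.trans (key hC' hv hwC).symm)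

theorem ConnectedSet.deleteEdges {C : Set V} {u v : V} (hC : G.ConnectedSet C)
    (h : ¬ (u ∈ C ∧ v ∈ C)) : (G.deleteEdges {s(u, v)}).ConnectedSet C := by
  intro A hA hne hAC
  obtain ⟨a, ha, b, hb, hab⟩ := hC A hA hne hAC
  refine ⟨a, ha, b, hb, ?_⟩
  rw [deleteEdges_adj]
  refine ⟨hab, ?_⟩
  simp only [Set.mem_singleton_iff, Sym2.eq_iff]
  rintro (⟨rfl, rfl⟩ | ⟨rfl, rfl⟩)
  · exact h ⟨hA ha, hb.1⟩
  · exact h ⟨hb.1, hA ha⟩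

/-- Only finitely many cuts of bounded size with both sides connected contain a given edge. -/
theorem finite_setOf_connectedSet_cut (n : ℕ) (G : SimpleGraph V) {u v : V} (huv : G.Adj u v) :
    {C : Set V | G.ConnectedSet C ∧ G.ConnectedSet Cᶜ ∧ u ∈ C ∧ v ∉ C ∧ (G.cutEdges C).Finite ∧
      (G.cutEdges C).ncard ≤ n}.Finite := by
  induction n generalizing G u v with
  | zero =>
    convert Set.finite_empty
    rw [Set.eq_empty_iff_forall_notMem]
    rintro C ⟨-, -, hu, hv, hf, h⟩
    have := (Set.ncard_eq_zero hf).1 (Nat.le_zero.1 h)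
    exact (this ▸ (⟨huv, hu, hv⟩ : (u, v) ∈ G.cutEdges C) : (u, v) ∈ (∅ : Set (V × V)))
  | succ n ih =>
    set G' := G.deleteEdges {s(u, v)} with hG'
    by_cases hr : G'.Reachable u v
    · obtain ⟨p⟩ := hr
      refine ((List.finite_toSet p.darts).biUnion fun d _ => ih G' d.adj).subset ?_
      rintro C ⟨h₁, h₂, hu, hv, hf, hn⟩
      obtain ⟨d, hd, hd₁, hd₂⟩ := p.exists_boundary_dart C hu hv
      have hsub : G'.cutEdges C ⊆ G.cutEdges C \ {(u, v)} := by
        rintro ⟨a, b⟩ ⟨hab, ha, hb⟩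
        rw [hG', deleteEdges_adj] at hab
        refine ⟨⟨hab.1, ha, hb⟩, ?_⟩
        rintro ⟨⟩
        exact hab.2 rfl
      refine Set.mem_biUnion hd ⟨h₁.deleteEdges (by tauto), h₂.deleteEdges ?_, hd₁, hd₂,
        hf.subset (hsub.trans Set.sdiff_subset), ?_⟩
      · exact fun h => h.1 hu
      · have h := Set.ncard_le_ncard hsub (hf.subset Set.sdiff_subset)
        rw [Set.ncard_sdiff_singleton_of_mem
          (a := (u, v)) (show (u, v) ∈ G.cutEdges C from ⟨huv, hu, hv⟩)] at h
        omega
    · refine (Set.finite_singleton {w | G'.Reachable u w}).subset ?_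
      rintro C ⟨h₁, h₂, hu, hv, -, -⟩
      exact (h₁.deleteEdges (by tauto)).eq_reachable (h₂.deleteEdges fun h => h.1 hu) hu hv hr

end SimpleGraph

/-- Two sets are nested if one of the four corners they determine is empty. -/
def NestedSets {V : Type*} (C D : Set V) : Prop :=
  C ⊆ D ∨ D ⊆ C ∨ C ⊆ Dᶜ ∨ Cᶜ ⊆ D

namespace NestedSets

variable {V : Type*} {C D F : Set V}

theorem symm (h : NestedSets C D) : NestedSets D C := by
  rcases h with h | h | h | h
  · exact Or.inr (Or.inl h)
  · exact Or.inl h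
  · exact Or.inr (Or.inr (Or.inl (Set.subset_compl_comm.1 h)))
  · exact Or.inr (Or.inr (Or.inr (Set.compl_subset_comm.1 h)))

theorem compl_left (h : NestedSets C D) : NestedSets Cᶜ D := by
  rcases h with h | h | h | h
  · exact Or.inr (Or.inr (Or.inr (by rwa [compl_compl])))
  · exact Or.inr (Or.inr (Or.inl (Set.compl_subset_compl.2 h)))
  · exact Or.inr (Or.inl (Set.subset_compl_comm.1 h))
  · exact Or.inl h

theorem compl_left_iff : NestedSets Cᶜ D ↔ NestedSets C D :=
  ⟨fun h => by simpa using h.compl_left, compl_left⟩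

theorem compl_right_iff : NestedSets C Dᶜ ↔ NestedSets C D :=
  ⟨fun h => (compl_left_iff.1 h.symm).symm, fun h => h.symm.compl_left.symm⟩

theorem corner_or (h : NestedSets C F) :
    NestedSets (C ∩ D) F ∨ NestedSets (Cᶜ ∩ Dᶜ) F := by
  rcases h with h | h | h | h
  · exact Or.inl (Or.inl fun x hx => h hx.1)
  · exact Or.inr (Or.inr (Or.inr (Or.inl fun x hx hF => hx.1 (h hF))))
  · exact Or.inl (Or.inr (Or.inr (Or.inl fun x hx => h hx.1)))
  · exact Or.inr (Or.inl fun x hx => h hx.1)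

theorem corner (hCD : ¬ NestedSets C D) (h₁ : NestedSets C F) (h₂ : NestedSets D F) :
    NestedSets (C ∩ D) F := by
  simp only [NestedSets, Set.subset_def, Set.mem_inter_iff, Set.mem_compl_iff] at *
  grind

theorem smul {H : Type*} [Group H] [MulAction H V] (g : H) (h : NestedSets C D) :
    NestedSets (g • C) (g • D) := by
  simpa only [NestedSets, ← Set.smul_set_compl, Set.smul_set_subset_smul_set_iff] using h

end NestedSets

theorem Ultrafilter.inter_mem_iff {V : Type*} {𝒰 : Ultrafilter V} {s t : Set V} :
    s ∩ t ∈ 𝒰 ↔ s ∈ 𝒰 ∧ t ∈ 𝒰 :=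
  Filter.inter_mem_iff

/-- A set separates two ultrafilters if it belongs to exactly one of them. -/
def Ultrafilter.SeparatedBy {V : Type*} (𝒰 𝒱 : Ultrafilter V) (C : Set V) : Prop :=
  ¬ (C ∈ 𝒰 ↔ C ∈ 𝒱)

theorem Ultrafilter.separatedBy_compl {V : Type*} {𝒰 𝒱 : Ultrafilter V} {C : Set V} :
    𝒰.SeparatedBy 𝒱 Cᶜ ↔ 𝒰.SeparatedBy 𝒱 C := by
  simp only [SeparatedBy, Ultrafilter.compl_mem_iff_notMem]
  tauto

namespace SimpleGraph

variable {V : Type*} (G : SimpleGraph V) (k : ℕ)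

/-- A cut of size at most `k` which is minimal among the finite cuts separating two given
ultrafilters. -/
structure IsMinCut (𝒰 𝒱 : Ultrafilter V) (C : Set V) : Prop where
  sep : 𝒰.SeparatedBy 𝒱 C
  finite : (G.cutEdges C).Finite
  le : (G.cutEdges C).ncard ≤ k
  min : ∀ D, 𝒰.SeparatedBy 𝒱 D → (G.cutEdges D).Finite →
    (G.cutEdges C).ncard ≤ (G.cutEdges D).ncard

/-- The minimal cuts that are not nested with a given set. -/
def crossing (C : Set V) : Set (Set V) :=
  {F | (∃ 𝒰 𝒱, G.IsMinCut k 𝒰 𝒱 F) ∧ ¬ NestedSets C F}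

/-- A minimal cut separating two ultrafilters that crosses as few minimal cuts as possible. -/
def IsOptCut (𝒰 𝒱 : Ultrafilter V) (C : Set V) : Prop :=
  G.IsMinCut k 𝒰 𝒱 C ∧
    ∀ D, G.IsMinCut k 𝒰 𝒱 D → (G.crossing k C).ncard ≤ (G.crossing k D).ncard

/-- The set of all optimal cuts. -/
def optCuts : Set (Set V) := {C | ∃ 𝒰 𝒱, G.IsOptCut k 𝒰 𝒱 C}

variable {G k} {𝒰 𝒱 𝒰' 𝒱' : Ultrafilter V} {C D : Set V}

theorem IsMinCut.compl (h : G.IsMinCut k 𝒰 𝒱 C) : G.IsMinCut k 𝒰 𝒱 Cᶜ where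
  sep := Ultrafilter.separatedBy_compl.2 h.sep
  finite := finite_cutEdges_compl.2 h.finite
  le := by rw [ncard_cutEdges_compl]; exact h.le
  min := by rw [ncard_cutEdges_compl]; exact h.min

theorem crossing_compl : G.crossing k Cᶜ = G.crossing k C := by
  simp only [crossing, NestedSets.compl_left_iff]

theorem IsOptCut.compl (h : G.IsOptCut k 𝒰 𝒱 C) : G.IsOptCut k 𝒰 𝒱 Cᶜ :=
  ⟨h.1.compl, by rw [crossing_compl]; exact h.2⟩

theorem compl_mem_optCuts (h : C ∈ G.optCuts k) : Cᶜ ∈ G.optCuts k := by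
  obtain ⟨𝒰, 𝒱, h⟩ := h
  exact ⟨𝒰, 𝒱, h.compl⟩

theorem IsMinCut.nonempty (h : G.IsMinCut k 𝒰 𝒱 C) : C.Nonempty := by
  rw [Set.nonempty_iff_ne_empty]
  rintro rfl
  exact h.sep (by simp)

theorem IsMinCut.connectedSet (hG : G.Preconnected) (h : G.IsMinCut k 𝒰 𝒱 C) :
    G.ConnectedSet C := by
  have key : ∀ A ⊆ C, A ≠ C → 𝒰.SeparatedBy 𝒱 A → ∃ u ∈ A, ∃ v ∈ C \ A, G.Adj u v := by
    intro A hA hne hs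
    by_contra! hno
    have hsub : G.cutEdges A ⊆ G.cutEdges C := by
      rintro d ⟨h₁, h₂, h₃⟩
      exact ⟨h₁, hA h₂, fun h₄ => hno _ h₂ _ ⟨h₄, h₃⟩ h₁⟩
    have heq := Set.eq_of_subset_of_ncard_le hsub (h.min A hs (h.finite.subset hsub)) h.finite
    have hB : (C \ A).Nonempty := by
      rw [Set.sdiff_nonempty]
      exact fun h' => hne (hA.antisymm h')
    obtain ⟨x, hx⟩ := h.compl.nonempty
    obtain ⟨d, h₁, h₂, h₃⟩ := cutEdges_nonempty hG hB ⟨x, fun h' => hx h'.1⟩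
    by_cases h₄ : d.2 ∈ C
    · exact hno _ (by_contra fun h' => h₃ ⟨h₄, h'⟩) _ h₂ h₁.symm
    · exact h₂.2 ((heq ▸ (⟨h₁, h₂.1, h₄⟩ : d ∈ G.cutEdges C) : d ∈ G.cutEdges A).2.1)
  intro A hA hne hAC
  by_cases hs : 𝒰.SeparatedBy 𝒱 A
  · exact key A hA hAC hs
  · have hs' : 𝒰.SeparatedBy 𝒱 (C \ A) := by
      have := h.sep
      simp only [Ultrafilter.SeparatedBy, Set.sdiff_eq, Ultrafilter.inter_mem_iff,
        Ultrafilter.compl_mem_iff_notMem] at this hs ⊢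
      have h₁ : A ∈ 𝒰 → C ∈ 𝒰 := fun h => Filter.mem_of_superset h hA
      have h₂ : A ∈ 𝒱 → C ∈ 𝒱 := fun h => Filter.mem_of_superset h hA
      tauto
    obtain ⟨u, hu, v, hv, huv⟩ := key _ Set.sdiff_subset (by
      intro h'
      obtain ⟨x, hx⟩ := hne
      exact (h'.ge (hA hx)).2 hx) hs'
    refine ⟨v, ?_, u, hu, huv.symm⟩
    by_contra h'
    exact hv.2 ⟨hv.1, h'⟩

theorem finite_crossing (hG : G.Preconnected) (hf : (G.cutEdges C).Finite) :
    (G.crossing k C).Finite := by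
  classical
  have p : ∀ a b, G.Walk a b := fun a b => (hG a b).some
  have h := (hf.prod hf).biUnion (t := fun e => ⋃ d ∈ (p e.1.1 e.2.1).darts,
    {F : Set V | G.ConnectedSet F ∧ G.ConnectedSet Fᶜ ∧ d.fst ∈ F ∧ d.snd ∉ F ∧
      (G.cutEdges F).Finite ∧ (G.cutEdges F).ncard ≤ k}) (by
    intro e _
    exact (List.finite_toSet _).biUnion fun d _ => finite_setOf_connectedSet_cut k G d.adj)
  refine h.subset ?_
  rintro F ⟨⟨𝒰, 𝒱, hF⟩, hn⟩
  have key : ∀ {D : Set V}, G.ConnectedSet D → ¬ D ⊆ C → ¬ D ⊆ Cᶜ →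
      ∃ d ∈ G.cutEdges C, d.1 ∈ D := by
    intro D hD h₁ h₂
    rw [Set.not_subset] at h₁ h₂
    obtain ⟨a, ha, ha'⟩ := h₁
    obtain ⟨b, hb, hb'⟩ := h₂
    obtain ⟨u, hu, v, hv, huv⟩ := hD.exists_adj (A := C) ⟨b, hb, not_not.1 hb'⟩ ⟨a, ha, ha'⟩
    exact ⟨(u, v), ⟨huv, hu.2, hv.2⟩, hu.1⟩
  have hFc := hF.connectedSet hG
  have hFc' := hF.compl.connectedSet hG
  obtain ⟨a, ha, haF⟩ := key hFc (fun h => hn (Or.inr (Or.inl h)))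
    (fun h => hn (Or.inr (Or.inr (Or.inl (Set.subset_compl_comm.1 h)))))
  obtain ⟨b, hb, hbF⟩ := key hFc' (fun h => hn (Or.inr (Or.inr (Or.inr
    (Set.compl_subset_comm.1 h))))) (fun h => hn (Or.inl (Set.compl_subset_compl.1 h)))
  obtain ⟨d, hd, hd₁, hd₂⟩ := (p a.1 b.1).exists_boundary_dart F haF hbF
  exact Set.mem_biUnion (x := (a, b)) ⟨ha, hb⟩
    (Set.mem_biUnion hd ⟨hFc, hFc', hd₁, hd₂, hF.finite, hF.le⟩)

theorem ncard_crossing_corners_lt (hG : G.Preconnected) (hC : G.IsMinCut k 𝒰 𝒱 C)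
    (hD : (G.cutEdges D).Finite) (hCD : ¬ NestedSets C D) :
    (G.crossing k (C ∩ D)).ncard + (G.crossing k (Cᶜ ∩ Dᶜ)).ncard <
      (G.crossing k C).ncard + (G.crossing k D).ncard := by
  have hCD' : ¬ NestedSets Cᶜ Dᶜ := by
    rwa [NestedSets.compl_left_iff, NestedSets.compl_right_iff]
  have hfC := finite_crossing (k := k) hG hC.finite
  have hfD := finite_crossing (k := k) hG hD
  have hf := finite_cutEdges_corners hC.finite hD
  rw [← Set.ncard_union_add_ncard_inter _ _ (finite_crossing hG hf.1) (finite_crossing hG hf.2),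
    ← Set.ncard_union_add_ncard_inter _ _ hfC hfD]
  refine add_lt_add_of_lt_of_le (Set.ncard_lt_ncard ?_ (hfC.union hfD))
    (Set.ncard_le_ncard ?_ (hfC.inter_of_left _))
  · refine ⟨?_, fun h => ?_⟩
    · rintro F (⟨hF, h⟩ | ⟨hF, h⟩)
      · by_contra hn
        simp only [crossing, Set.mem_union, Set.mem_ofPred_eq, hF, true_and, not_or, not_not] at hn
        exact h (NestedSets.corner hCD hn.1 hn.2)
      · by_contra hn
        simp only [crossing, Set.mem_union, Set.mem_ofPred_eq, hF, true_and, not_or, not_not] at hn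
        exact h (NestedSets.corner hCD' hn.1.compl_left hn.2.compl_left)
    · have hmem : C ∈ G.crossing k C ∪ G.crossing k D :=
        Or.inr ⟨⟨𝒰, 𝒱, hC⟩, fun h => hCD h.symm⟩
      rcases h hmem with ⟨-, h⟩ | ⟨-, h⟩
      · exact h (Or.inl Set.inter_subset_left)
      · exact h (Or.inr (Or.inr (Or.inl Set.inter_subset_left)))
  · rintro F ⟨⟨hF, h₁⟩, ⟨-, h₂⟩⟩
    refine ⟨⟨hF, fun h => ?_⟩, ⟨hF, fun h => ?_⟩⟩
    · exact (h.corner_or (D := D)).elim h₁ h₂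
    · have := h.corner_or (D := C)
      rw [Set.inter_comm D, Set.inter_comm Dᶜ] at this
      exact this.elim h₁ h₂

theorem IsOptCut.nested_of_corners (hG : G.Preconnected) (hC : G.IsOptCut k 𝒰 𝒱 C)
    (hD : G.IsOptCut k 𝒰' 𝒱' D) (h₁ : 𝒰.SeparatedBy 𝒱 (C ∩ D))
    (h₂ : 𝒰'.SeparatedBy 𝒱' (Cᶜ ∩ Dᶜ)) : NestedSets C D := by
  by_contra hn
  have hf := finite_cutEdges_corners hC.1.finite hD.1.finite
  have hle := ncard_cutEdges_corners_le hC.1.finite hD.1.finite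
  have hC' := hC.1.min _ h₁ hf.1
  have hD' := hD.1.min _ h₂ hf.2
  have hlt := ncard_crossing_corners_lt hG hC.1 hD.1.finite hn
  have hC₁ := hC.2 (C ∩ D) ⟨h₁, hf.1, le_trans (by omega) hC.1.le,
    fun F hF hF' => le_trans (by omega) (hC.1.min F hF hF')⟩
  have hD₁ := hD.2 (Cᶜ ∩ Dᶜ) ⟨h₂, hf.2, le_trans (by omega) hD.1.le,
    fun F hF hF' => le_trans (by omega) (hD.1.min F hF hF')⟩
  omega

theorem IsOptCut.nested_of_diagonals (hG : G.Preconnected) (hC : G.IsOptCut k 𝒰 𝒱 C)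
    (hD : G.IsOptCut k 𝒰' 𝒱' D) (h₁ : 𝒰.SeparatedBy 𝒱 (C ∩ D))
    (h₂ : 𝒰.SeparatedBy 𝒱 (Cᶜ ∩ Dᶜ)) (h₃ : 𝒰'.SeparatedBy 𝒱' (C ∩ Dᶜ))
    (h₄ : 𝒰'.SeparatedBy 𝒱' (Cᶜ ∩ D)) (h₅ : 𝒰.SeparatedBy 𝒱 D)
    (h₆ : 𝒰'.SeparatedBy 𝒱' C) : NestedSets C D := by
  have hf := finite_cutEdges_corners hC.1.finite hD.1.finite
  have hle := ncard_cutEdges_corners_le hC.1.finite hD.1.finite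
  have hf' := finite_cutEdges_corners hC.1.finite hD.1.compl.finite
  have hle' := ncard_cutEdges_corners_le hC.1.finite hD.1.compl.finite
  rw [compl_compl, ncard_cutEdges_compl D] at hle'
  rw [compl_compl] at hf'
  have e₁ := hC.1.min _ h₁ hf.1
  have e₂ := hC.1.min _ h₂ hf.2
  have e₃ := hD.1.min _ h₃ hf'.1
  have e₄ := hD.1.min _ h₄ hf'.2
  have hDm : G.IsMinCut k 𝒰 𝒱 D := ⟨h₅, hD.1.finite, hD.1.le,
    fun F hF hF' => le_trans (by omega) (hC.1.min F hF hF')⟩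
  have hCm : G.IsMinCut k 𝒰' 𝒱' C := ⟨h₆, hC.1.finite, hC.1.le,
    fun F hF hF' => le_trans (by omega) (hD.1.min F hF hF')⟩
  have hDo : G.IsOptCut k 𝒰 𝒱 D := ⟨hDm, fun F hF => (hD.2 C hCm).trans (hC.2 F hF)⟩
  exact hC.nested_of_corners hG hDo h₁ h₂

theorem nested_of_mem_optCuts (hG : G.Preconnected) (hC : C ∈ G.optCuts k)
    (hD : D ∈ G.optCuts k) : NestedSets C D := by
  obtain ⟨𝒰, 𝒱, hC⟩ := hC
  obtain ⟨𝒰', 𝒱', hD⟩ := hD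
  have n₁ := hC.nested_of_corners hG hD
  have n₂ := fun h₁ h₂ => NestedSets.compl_left_iff.1 (hC.compl.nested_of_corners hG hD h₁ h₂)
  have n₃ := fun h₁ h₂ => NestedSets.compl_right_iff.1 (hC.nested_of_corners hG hD.compl h₁ h₂)
  have n₄ := fun h₁ h₂ => NestedSets.compl_left_iff.1 (NestedSets.compl_right_iff.1
    (hC.compl.nested_of_corners hG hD.compl h₁ h₂))
  have n₅ := hC.nested_of_diagonals hG hD
  have n₆ := fun h₁ h₂ h₃ h₄ h₅ h₆ => NestedSets.compl_right_iff.1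
    (hC.nested_of_diagonals hG hD.compl h₁ h₂ h₃ h₄ h₅ h₆)
  have s₁ := hC.1.sep
  have s₂ := hD.1.sep
  simp only [Ultrafilter.SeparatedBy, Ultrafilter.inter_mem_iff,
    Ultrafilter.compl_mem_iff_notMem, compl_compl] at *
  generalize NestedSets C D = N at *
  generalize (C ∈ 𝒰) = c₁ at *
  generalize (C ∈ 𝒱) = c₂ at *
  generalize (D ∈ 𝒰) = d₁ at *
  generalize (D ∈ 𝒱) = d₂ at *
  generalize (C ∈ 𝒰') = c₃ at *
  generalize (C ∈ 𝒱') = c₄ at *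
  generalize (D ∈ 𝒰') = d₃ at *
  generalize (D ∈ 𝒱') = d₄ at *
  clear hC hD hG
  by_cases c₁ <;> by_cases c₂ <;> by_cases d₁ <;> by_cases d₂ <;> by_cases c₃ <;> by_cases c₄ <;>
    by_cases d₃ <;> by_cases d₄ <;> simp_all

theorem exists_isOptCut (hs : 𝒰.SeparatedBy 𝒱 C) (hf : (G.cutEdges C).Finite)
    (hk : (G.cutEdges C).ncard ≤ k) : ∃ D, G.IsOptCut k 𝒰 𝒱 D := by
  classical
  have hmin : ∃ D, G.IsMinCut k 𝒰 𝒱 D := by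
    have hex : ∃ n D, 𝒰.SeparatedBy 𝒱 D ∧ (G.cutEdges D).Finite ∧ (G.cutEdges D).ncard = n :=
      ⟨_, C, hs, hf, rfl⟩
    obtain ⟨D, h₁, h₂, h₃⟩ := Nat.find_spec hex
    have hle : ∀ F, 𝒰.SeparatedBy 𝒱 F → (G.cutEdges F).Finite →
        (G.cutEdges D).ncard ≤ (G.cutEdges F).ncard := fun F hF hF' => by
      rw [h₃]
      exact Nat.find_min' hex ⟨F, hF, hF', rfl⟩
    exact ⟨D, h₁, h₂, (hle C hs hf).trans hk, hle⟩
  have hex : ∃ n D, G.IsMinCut k 𝒰 𝒱 D ∧ (G.crossing k D).ncard = n := by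
    obtain ⟨D, hD⟩ := hmin
    exact ⟨_, D, hD, rfl⟩
  obtain ⟨D, h₁, h₂⟩ := Nat.find_spec hex
  refine ⟨D, h₁, fun F hF => ?_⟩
  rw [h₂]
  exact Nat.find_min' hex ⟨F, hF, rfl⟩

section Action

variable {H : Type*} [Group H] [MulAction H V]

theorem cutEdges_smul (hadj : ∀ (g : H) u v, G.Adj u v → G.Adj (g • u) (g • v)) (g : H)
    (C : Set V) : G.cutEdges (g • C) = (fun d : V × V => g • d) '' G.cutEdges C := by
  ext ⟨a, b⟩
  simp only [mem_cutEdges, Set.mem_image]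
  constructor
  · rintro ⟨h, ha, hb⟩
    refine ⟨(g⁻¹ • a, g⁻¹ • b), ⟨hadj _ _ _ h, Set.mem_smul_set_iff_inv_smul_mem.1 ha,
      fun h' => hb (Set.mem_smul_set_iff_inv_smul_mem.2 h')⟩, ?_⟩
    simp [Prod.smul_mk]
  · rintro ⟨⟨c, d⟩, ⟨h, hc, hd⟩, he⟩
    rw [Prod.smul_mk, Prod.mk.injEq] at he
    obtain ⟨rfl, rfl⟩ := he
    exact ⟨hadj _ _ _ h, Set.smul_mem_smul_set hc, fun h' => hd (Set.smul_mem_smul_set_iff.1 h')⟩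

theorem ncard_cutEdges_smul (hadj : ∀ (g : H) u v, G.Adj u v → G.Adj (g • u) (g • v)) (g : H)
    (C : Set V) : (G.cutEdges (g • C)).ncard = (G.cutEdges C).ncard := by
  rw [cutEdges_smul hadj, Set.ncard_image_of_injective _ (MulAction.injective g)]

theorem finite_cutEdges_smul (hadj : ∀ (g : H) u v, G.Adj u v → G.Adj (g • u) (g • v)) {g : H}
    (hC : (G.cutEdges C).Finite) : (G.cutEdges (g • C)).Finite := by
  rw [cutEdges_smul hadj]
  exact hC.image _

theorem separatedBy_map_smul (g : H) :
    (𝒰.map (g • ·)).SeparatedBy (𝒱.map (g • ·)) C ↔ 𝒰.SeparatedBy 𝒱 (g⁻¹ • C) := by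
  simp only [Ultrafilter.SeparatedBy, Ultrafilter.mem_map, Set.preimage_smul]

theorem IsMinCut.smul (hadj : ∀ (g : H) u v, G.Adj u v → G.Adj (g • u) (g • v)) (g : H)
    (h : G.IsMinCut k 𝒰 𝒱 C) :
    G.IsMinCut k (𝒰.map (g • ·)) (𝒱.map (g • ·)) (g • C) where
  sep := by rw [separatedBy_map_smul, inv_smul_smul]; exact h.sep
  finite := finite_cutEdges_smul hadj h.finite
  le := by rw [ncard_cutEdges_smul hadj]; exact h.le
  min := by
    intro D hD hD'
    rw [separatedBy_map_smul] at hD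
    rw [ncard_cutEdges_smul hadj, ← ncard_cutEdges_smul hadj g⁻¹ D]
    exact h.min _ hD (finite_cutEdges_smul hadj hD')

theorem crossing_smul (hadj : ∀ (g : H) u v, G.Adj u v → G.Adj (g • u) (g • v)) (g : H)
    (C : Set V) : G.crossing k (g • C) = (fun F : Set V => g • F) '' G.crossing k C := by
  ext F
  constructor
  · rintro ⟨⟨𝒰, 𝒱, hF⟩, hn⟩
    refine ⟨g⁻¹ • F, ⟨⟨_, _, hF.smul hadj g⁻¹⟩, fun h => hn ?_⟩, smul_inv_smul g F⟩
    simpa using h.smul g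
  · rintro ⟨F, ⟨⟨𝒰, 𝒱, hF⟩, hn⟩, rfl⟩
    refine ⟨⟨_, _, hF.smul hadj g⟩, fun h => hn ?_⟩
    simpa using h.smul g⁻¹

theorem smul_mem_optCuts (hadj : ∀ (g : H) u v, G.Adj u v → G.Adj (g • u) (g • v)) (g : H)
    (h : C ∈ G.optCuts k) : g • C ∈ G.optCuts k := by
  obtain ⟨𝒰, 𝒱, h, h'⟩ := h
  have hn : ∀ (g : H) (F : Set V), (G.crossing k (g • F)).ncard = (G.crossing k F).ncard := by
    intro g F
    rw [crossing_smul hadj, Set.ncard_image_of_injective _ (MulAction.injective g)]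
  refine ⟨_, _, h.smul hadj g, fun D hD => ?_⟩
  rw [hn, ← hn g⁻¹ D]
  refine h' _ ?_
  have := hD.smul hadj g⁻¹
  have e : ∀ 𝒲 : Ultrafilter V, (𝒲.map (g • ·)).map (g⁻¹ • ·) = 𝒲 := by
    intro 𝒲
    rw [Ultrafilter.map_map]
    convert Ultrafilter.map_id 𝒲
    ext x
    simp
  rwa [e, e] at this

end Action

end SimpleGraph

theorem SimpleGraph.connectedSet_of_walks {V : Type*} {G : SimpleGraph V} {C : Set V} {a : V}
    (h : ∀ c ∈ C, ∃ p : G.Walk a c, ∀ x ∈ p.support, x ∈ C) : G.ConnectedSet C := by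
  intro A hA hne hAC
  have key : ∀ D ⊆ C, a ∈ D → (C \ D).Nonempty → ∃ u ∈ D, ∃ v ∈ C \ D, G.Adj u v := by
    rintro D - haD ⟨c, hc, hcD⟩
    obtain ⟨p, hp⟩ := h c hc
    obtain ⟨d, hd, h₁, h₂⟩ := p.exists_boundary_dart D haD hcD
    exact ⟨_, h₁, _, ⟨hp _ (p.dart_snd_mem_support_of_mem_darts hd), h₂⟩, d.adj⟩
  have hd : (C \ A).Nonempty := by
    rw [Set.sdiff_nonempty]
    exact fun h' => hAC (hA.antisymm h')
  by_cases haA : a ∈ A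
  · exact key A hA haA hd
  · obtain ⟨c, hc⟩ := hne
    obtain ⟨p, hp⟩ := h c (hA hc)
    have haC := hp a p.start_mem_support
    obtain ⟨u, hu, v, hv, huv⟩ := key (C \ A) Set.sdiff_subset ⟨haC, haA⟩
      ⟨c, hA hc, fun h => h.2 hc⟩
    exact ⟨v, by_contra fun h' => hv.2 ⟨hv.1, h'⟩, u, hu, huv.symm⟩

section Cayley

variable {H X : Type} [Group H] {φ : X → H}

variable (φ) in
/-- The Cayley graph of `H` with respect to the elements `φ x`. -/
def cayleyGraph : SimpleGraph H :=
  SimpleGraph.fromRel fun a b => ∃ x, b = a * φ x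

theorem cayleyGraph_adj {a b : H} :
    (cayleyGraph φ).Adj a b ↔ a ≠ b ∧ ((∃ x, b = a * φ x) ∨ ∃ x, a = b * φ x) :=
  SimpleGraph.fromRel_adj _ _ _

theorem cayleyGraph_adj_smul (g a b : H) (h : (cayleyGraph φ).Adj a b) :
    (cayleyGraph φ).Adj (g • a) (g • b) := by
  rw [cayleyGraph_adj] at h ⊢
  simpa [smul_eq_mul, mul_assoc] using h

theorem finite_cayleyGraph_adj [Fintype X] (b : H) : {a | (cayleyGraph φ).Adj a b}.Finite := by
  refine ((Set.finite_range fun x => b * (φ x)⁻¹).union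
    (Set.finite_range fun x => b * φ x)).subset ?_
  rintro a h
  rw [Set.mem_ofPred_eq, cayleyGraph_adj] at h
  rcases h.2 with ⟨x, rfl⟩ | ⟨x, rfl⟩
  · exact Or.inl ⟨x, by simp⟩
  · exact Or.inr ⟨x, rfl⟩

theorem exists_walk_wordVal (r : List X) (a : H) :
    ∃ p : (cayleyGraph φ).Walk a (a * wordVal φ r), ∀ c ∈ p.support,
      ∃ r₁ r₂, r = r₁ ++ r₂ ∧ c = a * wordVal φ r₁ := by
  induction r generalizing a with
  | nil =>
    refine ⟨SimpleGraph.Walk.nil.copy rfl (by simp [wordVal]), ?_⟩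
    intro c hc
    rw [SimpleGraph.Walk.support_copy] at hc
    exact ⟨[], [], rfl, by simpa [wordVal] using hc⟩
  | cons x r ih =>
    obtain ⟨p, hp⟩ := ih (a * φ x)
    have he : a * φ x * wordVal φ r = a * wordVal φ (x :: r) := by simp [wordVal, mul_assoc]
    have hp' : ∀ c ∈ p.support, ∃ r₁ r₂, x :: r = r₁ ++ r₂ ∧ c = a * wordVal φ r₁ := by
      intro c hc
      obtain ⟨r₁, r₂, rfl, rfl⟩ := hp c hc
      exact ⟨x :: r₁, r₂, rfl, by simp [wordVal, mul_assoc]⟩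
    by_cases hx : a = a * φ x
    · exact ⟨p.copy hx.symm he, fun c hc => hp' c (by simpa using hc)⟩
    · refine ⟨(SimpleGraph.Walk.cons (cayleyGraph_adj.2 ⟨hx, Or.inl ⟨x, rfl⟩⟩) p).copy rfl he, ?_⟩
      intro c hc
      rw [SimpleGraph.Walk.support_copy, SimpleGraph.Walk.support_cons, List.mem_cons] at hc
      rcases hc with rfl | hc
      · exact ⟨[], _, rfl, by simp [wordVal]⟩
      · exact hp' c hc

theorem cayleyGraph_preconnected (hgen : ∀ h : H, ∃ w, wordVal φ w = h) :
    (cayleyGraph φ).Preconnected := by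
  intro a b
  obtain ⟨w, hw⟩ := hgen (a⁻¹ * b)
  obtain ⟨p, -⟩ := exists_walk_wordVal (φ := φ) w a
  exact ⟨p.copy rfl (by rw [hw, mul_inv_cancel_left])⟩

theorem finite_wordVal_length_le [Fintype X] (N : ℕ) :
    {h : H | ∃ r : List X, r.length ≤ N ∧ wordVal φ r = h}.Finite :=
  ((List.finite_length_le X N).image (wordVal φ)).subset
    fun _ ⟨r, hr, hh⟩ => ⟨r, hr, hh⟩

theorem exists_word_of_walk [Fintype X] (hgen : ∀ h : H, ∃ w, wordVal φ w = h) :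
    ∃ D : ℕ, ∀ {a b : H} (p : (cayleyGraph φ).Walk a b), ∃ z, wordVal φ z = a⁻¹ * b ∧
      ∀ z₁ z₂, z = z₁ ++ z₂ → ∃ c ∈ p.support, ∃ r, r.length ≤ D ∧
        a * wordVal φ z₁ * wordVal φ r = c := by
  choose wd hwd using hgen
  obtain ⟨D, hD⟩ := (Set.finite_range fun x => (wd (φ x)⁻¹).length).bddAbove
  refine ⟨D + 1, fun {a b} p => ?_⟩
  induction p with
  | nil =>
    refine ⟨[], by simp [wordVal], fun z₁ z₂ h => ?_⟩
    obtain ⟨rfl, rfl⟩ := List.append_eq_nil_iff.1 h.symm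
    exact ⟨_, SimpleGraph.Walk.start_mem_support _, [], by simp, by simp [wordVal]⟩
  | @cons a b c h p ih =>
    obtain ⟨t, ht, ht'⟩ : ∃ t, t.length ≤ D + 1 ∧ wordVal φ t = a⁻¹ * b := by
      rcases (cayleyGraph_adj.1 h).2 with ⟨x, rfl⟩ | ⟨x, rfl⟩
      · exact ⟨[x], by simp, by simp [wordVal]⟩
      · exact ⟨wd (φ x)⁻¹, (hD ⟨x, rfl⟩).trans (by omega), by rw [hwd]; group⟩
    obtain ⟨z, hz, hz'⟩ := ih
    refine ⟨t ++ z, by rw [wordVal_append, ht', hz]; group, fun z₁ z₂ he => ?_⟩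
    rcases List.append_eq_append_iff.1 he with ⟨a', rfl, h₂⟩ | ⟨c', rfl, h₂⟩
    · obtain ⟨d, hd, r, hr, hr'⟩ := hz' _ _ h₂
      exact ⟨d, by simp [hd], r, hr, by rw [← hr', wordVal_append, ht']; group⟩
    · refine ⟨b, by simp, c', ?_, ?_⟩
      · rw [List.length_append] at ht
        omega
      · rw [wordVal_append] at ht'
        rw [mul_assoc, ht']
        group

/-- A word of minimal length among those representing the same element. -/
def IsGeodesic (φ : X → H) (w : List X) : Prop :=
  ∀ u, wordVal φ u = wordVal φ w → w.length ≤ u.length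

theorem exists_isGeodesic (hgen : ∀ h : H, ∃ w, wordVal φ w = h) (h : H) :
    ∃ w, wordVal φ w = h ∧ IsGeodesic φ w := by
  classical
  have hex : ∃ n w, wordVal φ w = h ∧ w.length = n := by
    obtain ⟨w, hw⟩ := hgen h
    exact ⟨_, w, hw, rfl⟩
  obtain ⟨w, h₁, h₂⟩ := Nat.find_spec hex
  exact ⟨w, h₁, fun u hu => h₂ ▸ Nat.find_min' hex ⟨u, hu.trans h₁, rfl⟩⟩

theorem IsGeodesic.of_append {u v : List X} (h : IsGeodesic φ (u ++ v)) : IsGeodesic φ u := by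
  intro w hw
  have := h (w ++ v) (by rw [wordVal_append, wordVal_append, hw])
  simpa using this

/-- Every walk from `k` to `1` passes close to each point of a geodesic from `1` to `k`. -/
theorem exists_bottleneck_walk [Fintype X] (hgen : ∀ h : H, ∃ w, wordVal φ w = h)
    (hB : ∃ R : ℕ, ∀ w₁ w₂ z, wordVal φ (w₁ ++ w₂ ++ z) = 1 →
      (∀ u, wordVal φ u = wordVal φ (w₁ ++ w₂) → (w₁ ++ w₂).length ≤ u.length) →
      ∃ z₁ z₂ r, z = z₁ ++ z₂ ∧ r.length ≤ R ∧ wordVal φ r = wordVal φ (w₂ ++ z₁)) :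
    ∃ N : ℕ, ∀ w₁ w₂, IsGeodesic φ (w₁ ++ w₂) →
      ∀ p : (cayleyGraph φ).Walk (wordVal φ (w₁ ++ w₂)) 1, ∃ c ∈ p.support,
        ∃ r : List X, r.length ≤ N ∧ wordVal φ w₁ * wordVal φ r = c := by
  obtain ⟨R, hR⟩ := hB
  obtain ⟨D, hD⟩ := exists_word_of_walk hgen
  refine ⟨R + D, fun w₁ w₂ hw p => ?_⟩
  obtain ⟨z, hz, hz'⟩ := hD p
  obtain ⟨z₁, z₂, r, rfl, hr, hr'⟩ := hR w₁ w₂ z (by rw [wordVal_append, hz]; group) hw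
  obtain ⟨c, hc, r', hr₁, hr₂⟩ := hz' z₁ z₂ rfl
  refine ⟨c, hc, r ++ r', by rw [List.length_append]; omega, ?_⟩
  rw [← hr₂, wordVal_append, hr']
  simp only [wordVal_append, mul_assoc]

end Cayley

namespace SimpleGraph

variable {V : Type*} {G : SimpleGraph V}

/-- The component of a vertex in the complement of a set of vertices. -/
def componentAvoiding (G : SimpleGraph V) (B : Set V) (a : V) : Set V :=
  {h | ∃ p : G.Walk a h, ∀ c ∈ p.support, c ∉ B}

variable {B : Set V} {a : V}

theorem componentAvoiding_subset : G.componentAvoiding B a ⊆ Bᶜ :=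
  fun _ ⟨p, hp⟩ => hp _ p.end_mem_support

theorem self_mem_componentAvoiding (ha : a ∉ B) : a ∈ G.componentAvoiding B a :=
  ⟨.nil, by simpa using ha⟩

theorem support_subset_componentAvoiding {h : V} (p : G.Walk a h) (hp : ∀ c ∈ p.support, c ∉ B) :
    ∀ c ∈ p.support, c ∈ G.componentAvoiding B a := by
  classical
  exact fun c hc => ⟨p.takeUntil c hc, fun d hd => hp d (p.support_takeUntil_subset_support hc hd)⟩

theorem mem_of_mem_cutEdges_componentAvoiding {d : V × V}
    (h : d ∈ G.cutEdges (G.componentAvoiding B a)) : d.2 ∈ B := by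
  obtain ⟨hadj, ⟨p, hp⟩, h₂⟩ := h
  by_contra hd
  refine h₂ ⟨p.concat hadj, fun c hc => ?_⟩
  rw [Walk.support_concat, List.mem_append, List.mem_singleton] at hc
  rcases hc with hc | rfl
  · exact hp c hc
  · exact hd

theorem connectedSet_componentAvoiding : G.ConnectedSet (G.componentAvoiding B a) :=
  connectedSet_of_walks fun _ ⟨p, hp⟩ => ⟨p, support_subset_componentAvoiding p hp⟩

theorem connectedSet_compl_componentAvoiding (hG : G.Preconnected) (ha : a ∉ B)
    (hB : G.ConnectedSet B) : G.ConnectedSet (G.componentAvoiding B a)ᶜ := by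
  intro A hA hne hAC
  by_contra! hno
  have key : ∀ D ⊆ (G.componentAvoiding B a)ᶜ, D.Nonempty →
      (∀ u ∈ D, ∀ v ∈ (G.componentAvoiding B a)ᶜ \ D, ¬ G.Adj u v) → (B ∩ D).Nonempty := by
    intro D hD hne hno
    obtain ⟨d, hadj, h₁, h₂⟩ := cutEdges_nonempty hG hne
      ⟨a, fun h => hD h (self_mem_componentAvoiding ha)⟩
    by_cases h₃ : d.2 ∈ G.componentAvoiding B a
    · exact ⟨d.1, mem_of_mem_cutEdges_componentAvoiding (d := d.swap) ⟨hadj.symm, h₃, hD h₁⟩, h₁⟩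
    · exact absurd hadj (hno _ h₁ _ ⟨h₃, h₂⟩)
  have hd : ((G.componentAvoiding B a)ᶜ \ A).Nonempty := by
    rw [Set.sdiff_nonempty]
    exact fun h' => hAC (hA.antisymm h')
  have h₁ := key A hA hne hno
  obtain ⟨x, hxB, hx⟩ := key _ Set.sdiff_subset hd (by
    intro u hu v hv huv
    exact hno v (by_contra fun h => hv.2 ⟨hv.1, h⟩) u hu huv.symm)
  obtain ⟨u, hu, v, hv, huv⟩ := hB.exists_adj h₁ ⟨x, hxB, hx.2⟩
  exact hno u hu.2 v ⟨fun h => componentAvoiding_subset h hv.1, hv.2⟩ huv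

/-- If a complementary component of a connected set crosses a translate then the set meets its
translate. -/
theorem inter_smul_nonempty_of_not_nested {H : Type*} [Group H] [MulAction H V]
    (hadj : ∀ (g : H) u v, G.Adj u v → G.Adj (g • u) (g • v)) (hG : G.Preconnected) (ha : a ∉ B)
    (hB : ∀ g : H, G.ConnectedSet (g • B)) {k : H}
    (h : ¬ NestedSets (G.componentAvoiding B a) (k • G.componentAvoiding B a)) :
    (B ∩ k • B).Nonempty := by
  set W := G.componentAvoiding B a
  have hout : ∀ u v, G.Adj u v → u ∈ k • W → v ∉ k • W → v ∈ k • B := by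
    intro u v huv hu hv
    rw [Set.mem_smul_set_iff_inv_smul_mem] at hu hv ⊢
    exact mem_of_mem_cutEdges_componentAvoiding (d := (k⁻¹ • u, k⁻¹ • v))
      ⟨hadj _ _ _ huv, hu, hv⟩
  simp only [NestedSets, Set.not_subset, not_or] at h
  obtain ⟨⟨x₁, h₁, h₁'⟩, ⟨x₂, h₂, h₂'⟩, ⟨x₃, h₃, h₃'⟩, ⟨x₄, h₄, h₄'⟩⟩ := h
  obtain ⟨u, hu, v, hv, huv⟩ := connectedSet_componentAvoiding.exists_adj (C := W) (A := k • W)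
    ⟨x₃, h₃, not_not.1 h₃'⟩ ⟨x₁, h₁, h₁'⟩
  obtain ⟨u', hu', v', hv', huv'⟩ := (connectedSet_compl_componentAvoiding hG ha
    (by simpa using hB 1)).exists_adj (A := k • W) ⟨x₂, h₂', h₂⟩ ⟨x₄, h₄, h₄'⟩
  obtain ⟨y, hy, z, hz, hyz⟩ := (hB k).exists_adj (A := W) ⟨v, hout _ _ huv hu.2 hv.2, hv.1⟩
    ⟨v', hout _ _ huv' hu'.2 hv'.2, hv'.1⟩
  exact ⟨z, mem_of_mem_cutEdges_componentAvoiding (d := (y, z)) ⟨hyz, hy.2, hz.2⟩, hz.1⟩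

/-- The setwise stabiliser of a set with finite nonempty boundary embeds in that boundary, if the
action on the vertices is free. -/
theorem ncard_stabilizer_le {H : Type*} [Group H] [MulAction H V]
    (hadj : ∀ (g : H) u v, G.Adj u v → G.Adj (g • u) (g • v))
    (hfree : ∀ (g h : H) (v : V), g • v = h • v → g = h) {C : Set V}
    (hf : (G.cutEdges C).Finite) (hne : (G.cutEdges C).Nonempty) :
    {k : H | k • C = C}.Finite ∧ {k : H | k • C = C}.ncard ≤ (G.cutEdges C).ncard := by
  obtain ⟨d, hd⟩ := hne
  have hmaps : ∀ k ∈ {k : H | k • C = C}, (fun k : H => k • d) k ∈ G.cutEdges C := by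
    intro k hk
    have := (cutEdges_smul hadj k C).ge ⟨d, hd, rfl⟩
    rwa [show k • C = C from hk] at this
  have hinj : Set.InjOn (fun k : H => k • d) {k : H | k • C = C} := by
    intro g _ h _ hgh
    exact hfree g h d.1 (congrArg Prod.fst hgh)
  exact ⟨Set.Finite.of_injOn hmaps hinj hf, Set.ncard_le_ncard_of_injOn _ hmaps hinj hf⟩

end SimpleGraph

section Splitting

variable {H X : Type} [Group H] {φ : X → H}

theorem smul_componentAvoiding_eq_of_nested {B : Set H} (hB1 : (1 : H) ∉ B) {K : Subgroup H}
    (hfin : (↑K ∩ (cayleyGraph φ).componentAvoiding B 1).Finite)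
    (hinf : (↑K ∩ ((cayleyGraph φ).componentAvoiding B 1)ᶜ).Infinite) {k : H}
    (hk : k ∈ K) (hkW : k ∈ (cayleyGraph φ).componentAvoiding B 1)
    (hn : NestedSets ((cayleyGraph φ).componentAvoiding B 1)
      (k • (cayleyGraph φ).componentAvoiding B 1)) :
    k • (cayleyGraph φ).componentAvoiding B 1 = (cayleyGraph φ).componentAvoiding B 1 := by
  set W := (cayleyGraph φ).componentAvoiding B 1 with hWdef
  have h1 : (1 : H) ∈ W := SimpleGraph.self_mem_componentAvoiding hB1
  have hkK : ∀ k ∈ K, ∀ S : Set H, (K : Set H) ∩ k • S = k • ((K : Set H) ∩ S) := by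
    intro k hk S
    rw [Set.smul_set_inter]
    congr 1
    ext x
    rw [Set.mem_smul_set_iff_inv_smul_mem, smul_eq_mul, SetLike.mem_coe, SetLike.mem_coe,
      K.mul_mem_cancel_left (K.inv_mem hk)]
  have key : ∀ k ∈ K, W ⊆ k • W → k • W ⊆ W := by
    intro k hk hsub
    have hA : (K : Set H) ∩ W = k • ((K : Set H) ∩ W) := by
      refine Set.eq_of_subset_of_ncard_le ?_ ?_ (hfin.smul_set)
      · rw [← hkK k hk]
        exact Set.inter_subset_inter_right _ hsub
      · rw [Set.ncard_smul_set]
    have hpow : ∀ n : ℕ, k ^ n ∈ (K : Set H) ∩ W := by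
      intro n
      induction n with
      | zero => exact ⟨by simp, by simpa using h1⟩
      | succ n ih =>
        rw [hA, pow_succ', ← smul_eq_mul]
        exact Set.smul_mem_smul_set ih
    have hord : IsOfFinOrder k := by
      rw [← not_not (a := IsOfFinOrder k), ← injective_pow_iff_not_isOfFinOrder]
      intro hinj
      exact Set.infinite_of_injective_forall_mem hinj hpow hfin
    have hsub' : ∀ n : ℕ, W ⊆ k ^ n • W := by
      intro n
      induction n with
      | zero => simp
      | succ n ih =>
        rw [pow_succ', mul_smul]
        exact hsub.trans (Set.smul_set_mono ih)
    obtain ⟨n, hn, hkn⟩ := isOfFinOrder_iff_pow_eq_one.1 hord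
    have := Set.smul_set_mono (a := k) (hsub' (n - 1))
    rwa [← mul_smul, ← pow_succ', Nat.sub_add_cancel hn, hkn, one_smul] at this
  rcases hn with h | h | h | h
  · exact (key k hk h).antisymm h
  · refine h.antisymm ?_
    have h' := key k⁻¹ (K.inv_mem hk) (by
      rwa [← Set.smul_set_subset_smul_set_iff (a := k), smul_inv_smul])
    rwa [← Set.smul_set_subset_smul_set_iff (a := k), smul_inv_smul] at h'
  · exact absurd (Set.smul_mem_smul_set (a := k) h1) (by simpa using h hkW)
  · refine absurd ?_ hinf
    refine (hfin.smul_set (a := k)).subset ?_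
    rw [← hkK k hk]
    exact Set.inter_subset_inter_right _ h

theorem exists_infinite_take_eq [Fintype X] {S : Set H} (hS : S.Infinite) (r : ℕ)
    {geo : H → List X} (hgeo : ∀ k, wordVal φ (geo k) = k) :
    ∃ w : List X, w.length = r ∧ {k ∈ S | (geo k).take r = w}.Infinite := by
  by_contra! hno
  refine hS (((finite_wordVal_length_le (φ := φ) r).union
    ((List.finite_length_eq X r).biUnion fun w hw => hno w hw)).subset fun k hk => ?_)
  rcases le_total (geo k).length r with h | h
  · exact Or.inl ⟨geo k, h, hgeo k⟩
  · exact Or.inr (Set.mem_biUnion (x := (geo k).take r) (by simpa using h) ⟨hk, rfl⟩)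

/-- Every infinite subgroup is split by a set with small boundary. -/
theorem exists_splitting [Fintype X] (hgen : ∀ h : H, ∃ w, wordVal φ w = h) {N : ℕ}
    (hN : ∀ w₁ w₂, IsGeodesic φ (w₁ ++ w₂) →
      ∀ p : (cayleyGraph φ).Walk (wordVal φ (w₁ ++ w₂)) 1, ∃ c ∈ p.support,
        ∃ r : List X, r.length ≤ N ∧ wordVal φ w₁ * wordVal φ r = c) :
    ∃ k₀, ∀ K : Subgroup H, (K : Set H).Infinite → ∃ C,
      ((cayleyGraph φ).cutEdges C).Finite ∧ ((cayleyGraph φ).cutEdges C).ncard ≤ k₀ ∧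
      (↑K ∩ C).Infinite ∧ (↑K ∩ Cᶜ).Infinite := by
  classical
  set Γ := cayleyGraph φ
  have hG : Γ.Preconnected := cayleyGraph_preconnected hgen
  choose geo hgeo hgeo' using exists_isGeodesic hgen
  set B₀ : Set H := {h | ∃ r : List X, r.length ≤ N ∧ wordVal φ r = h} with hB₀
  have hB₀f : B₀.Finite := finite_wordVal_length_le N
  have hconn : ∀ g : H, Γ.ConnectedSet (g • B₀) := by
    intro g
    refine SimpleGraph.connectedSet_of_walks (a := g) ?_
    rintro _ ⟨_, ⟨r, hr, rfl⟩, rfl⟩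
    obtain ⟨p, hp⟩ := exists_walk_wordVal (φ := φ) r g
    refine ⟨p, fun c hc => ?_⟩
    obtain ⟨r₁, r₂, rfl, rfl⟩ := hp c hc
    exact ⟨wordVal φ r₁, ⟨r₁, by rw [List.length_append] at hr; omega, rfl⟩, rfl⟩
  set D : Set (H × H) := {d | Γ.Adj d.1 d.2 ∧ d.2 ∈ B₀} with hD
  have hDf : D.Finite := by
    refine (hB₀f.biUnion fun v _ => (finite_cayleyGraph_adj (φ := φ) v).prod
      (Set.finite_singleton v)).subset ?_
    rintro ⟨u, v⟩ ⟨h, hv⟩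
    exact Set.mem_biUnion hv ⟨h, rfl⟩
  have hBBf : (B₀ * B₀⁻¹).Finite := hB₀f.mul hB₀f.inv
  refine ⟨D.ncard, fun K hK => ?_⟩
  by_contra! hno
  obtain ⟨S', hS'K, hS'card⟩ := hK.exists_subset_card_eq ((B₀ * B₀⁻¹).ncard + D.ncard + 1)
  set S : Finset H := insert 1 S'
  have p : ∀ s, Γ.Walk 1 s := fun s => (hG 1 s).some
  set Y : Set H := ⋃ s ∈ S, {c | c ∈ (p s).support}
  have hYf : Y.Finite := S.finite_toSet.biUnion fun s _ => List.finite_toSet _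
  obtain ⟨r, hr⟩ := ((hYf.mul hB₀f.inv).image fun h => (geo h).length).bddAbove
  obtain ⟨w, hwlen, hwinf⟩ := exists_infinite_take_eq hK (r + 1) hgeo
  set m := wordVal φ w with hm
  have hinf : {k ∈ (K : Set H) | (geo k).take (r + 1) = w}.Infinite := hwinf
  obtain ⟨k₁, hk₁⟩ := hinf.nonempty
  have hw : IsGeodesic φ w := by
    have := hgeo' k₁
    rw [← List.take_append_drop (r + 1) (geo k₁), hk₁.2] at this
    exact this.of_append
  have hmY : ∀ y ∈ Y, y ∉ m • B₀ := by
    rintro y hy ⟨b, hb, hbm⟩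
    have h₁ : m ∈ Y * B₀⁻¹ := ⟨y, hy, b⁻¹, by simpa using hb, by
      rw [← hbm]; simp⟩
    have h₂ := hr ⟨m, h₁, rfl⟩
    have h₃ := hw (geo m) (hgeo m)
    simp only at h₂
    omega
  set B := m • B₀ with hBdef
  set W := Γ.componentAvoiding B 1 with hW
  have hY1 : (1 : H) ∈ Y := Set.mem_biUnion (Finset.mem_insert_self 1 S')
    (SimpleGraph.Walk.start_mem_support _)
  have hB1 := hmY 1 hY1
  have hSW : ∀ s ∈ S, s ∈ W := fun s hs =>
    ⟨p s, fun c hc => hmY c (Set.mem_biUnion hs hc)⟩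
  have hout : ∀ k ∈ {k ∈ (K : Set H) | (geo k).take (r + 1) = w}, k ∈ (K : Set H) ∩ Wᶜ := by
    rintro k ⟨hkK, hk⟩
    refine ⟨hkK, ?_⟩
    rintro ⟨q, hq⟩
    have hsplit : geo k = w ++ (geo k).drop (r + 1) := by rw [← hk, List.take_append_drop]
    have hval : wordVal φ (w ++ (geo k).drop (r + 1)) = k := by rw [← hsplit, hgeo]
    obtain ⟨c, hc, t, ht, hct⟩ := hN w ((geo k).drop (r + 1)) (hsplit ▸ hgeo' k)
      (q.reverse.copy hval.symm rfl)
    rw [SimpleGraph.Walk.support_copy, SimpleGraph.Walk.support_reverse, List.mem_reverse] at hc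
    exact hq c hc ⟨wordVal φ t, ⟨t, ht, rfl⟩, hct⟩
  have hWc : ((K : Set H) ∩ Wᶜ).Infinite := hinf.mono hout
  have hcut : Γ.cutEdges W ⊆ m • D := by
    rintro ⟨u, v⟩ h
    obtain ⟨b, hb, hbm⟩ : v ∈ B := SimpleGraph.mem_of_mem_cutEdges_componentAvoiding h
    refine ⟨(m⁻¹ • u, b), ⟨?_, hb⟩, ?_⟩
    · have := cayleyGraph_adj_smul m⁻¹ _ _ h.1
      simpa [← hbm] using this
    · simpa using hbm
  have hmDf : (m • D).Finite := hDf.smul_set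
  have hcutf : (Γ.cutEdges W).Finite := hmDf.subset hcut
  have hcutn : (Γ.cutEdges W).ncard ≤ D.ncard := by
    have := Set.ncard_le_ncard hcut hmDf
    rwa [Set.ncard_smul_set] at this
  have hAf : ((K : Set H) ∩ W).Finite := by
    by_contra hA
    exact hWc (hno W hcutf hcutn hA)
  have hWne : (Γ.cutEdges W).Nonempty :=
    SimpleGraph.cutEdges_nonempty hG ⟨1, SimpleGraph.self_mem_componentAvoiding hB1⟩
      (hWc.nonempty.mono Set.inter_subset_right)
  obtain ⟨hst, hst' : _ ≤ (Γ.cutEdges W).ncard⟩ :=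
    SimpleGraph.ncard_stabilizer_le (H := H) (cayleyGraph_adj_smul (φ := φ))
      (fun g h v hgh => by simpa using hgh) hcutf hWne
  have hcov : (S' : Set H) ⊆ {k : H | k • W = W} ∪ (fun x => m * x * m⁻¹) '' (B₀ * B₀⁻¹) := by
    intro k hk
    by_cases hn : NestedSets W (k • W)
    · left
      exact smul_componentAvoiding_eq_of_nested hB1 hAf hWc (hS'K hk)
        (hSW k (Finset.mem_insert_of_mem hk)) hn
    · right
      obtain ⟨x, ⟨b, hb, rfl⟩, ⟨_, ⟨b', hb', rfl⟩, h⟩⟩ :=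
        SimpleGraph.inter_smul_nonempty_of_not_nested (cayleyGraph_adj_smul (φ := φ)) hG hB1
          (fun g => by rw [hBdef, ← mul_smul]; exact hconn _) hn
      refine ⟨b * b'⁻¹, Set.mul_mem_mul hb (by simpa using hb'), ?_⟩
      simp only [smul_eq_mul] at h ⊢
      rw [mul_assoc, mul_assoc, ← mul_inv_rev, ← mul_assoc, ← h]
      group
  have hle := Set.ncard_le_ncard hcov (hst.union (hBBf.image _))
  have h₁ := Set.ncard_union_le {k : H | k • W = W} ((fun x => m * x * m⁻¹) '' (B₀ * B₀⁻¹))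
  have h₂ := Set.ncard_image_le (f := fun x => m * x * m⁻¹) hBBf
  rw [Set.ncard_coe_finset] at hle
  omega

end Splitting

/-- A nested system of proper cuts, finitely many of which separate any two points. -/
structure IsCutSystem {V : Type*} (E : Set (Set V)) : Prop where
  compl_mem : ∀ C ∈ E, Cᶜ ∈ E
  nonempty : ∀ C ∈ E, C.Nonempty
  nested : ∀ C ∈ E, ∀ D ∈ E, NestedSets C D
  finite : ∀ u v, {C ∈ E | u ∈ C ∧ v ∉ C}.Finite

/-- A consistent choice of sides, almost all of which contain any given point. -/
structure IsOrientation {V : Type*} (E o : Set (Set V)) : Prop where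
  subset : o ⊆ E
  mem_or : ∀ C ∈ E, C ∈ o ∨ Cᶜ ∈ o
  notMem : ∀ C ∈ o, Cᶜ ∉ o
  mono : ∀ C ∈ o, ∀ D ∈ E, C ⊆ D → D ∈ o
  finite : ∀ a, {C ∈ o | a ∉ C}.Finite

namespace IsOrientation

variable {V : Type*} {E o o' : Set (Set V)} {C : Set V}

theorem compl_mem (ho : IsOrientation E o) (hC : C ∈ E) (h : C ∉ o) : Cᶜ ∈ o :=
  (ho.mem_or C hC).resolve_left h

theorem of_point (hE : IsCutSystem E) (a : V) : IsOrientation E {C ∈ E | a ∈ C} where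
  subset := fun _ h => h.1
  mem_or := fun C hC => by
    by_cases h : a ∈ C
    · exact Or.inl ⟨hC, h⟩
    · exact Or.inr ⟨hE.compl_mem C hC, h⟩
  notMem := fun C h h' => h'.2 h.2
  mono := fun C h D hD hCD => ⟨hD, hCD h.2⟩
  finite := fun b => (hE.finite a b).subset fun C h => ⟨h.1.1, h.1.2, h.2⟩

theorem sdiff_eq_compl (ho : IsOrientation E o) (ho' : IsOrientation E o') :
    o' \ o = compl '' (o \ o') := by
  ext C
  rw [compl_involutive.image_eq_preimage_symm, Set.mem_preimage]
  constructor
  · rintro ⟨h, h'⟩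
    exact ⟨ho.compl_mem (ho'.subset h) h', ho'.notMem _ h⟩
  · rintro ⟨h, h'⟩
    have h₁ := ho'.compl_mem (ho.subset h) h'
    have h₂ := ho.notMem _ h
    rw [compl_compl] at h₁ h₂
    exact ⟨h₁, h₂⟩

theorem sdiff_finite [Nonempty V] (ho : IsOrientation E o)
    (ho' : IsOrientation E o') : (o \ o').Finite := by
  obtain ⟨a⟩ := ‹Nonempty V›
  refine ((ho.finite a).union ((ho'.finite a).image compl)).subset fun C hC => ?_
  by_cases h : a ∈ C
  · refine Or.inr ⟨Cᶜ, ⟨ho'.compl_mem (ho.subset hC.1) hC.2, fun h' => h' h⟩, compl_compl C⟩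
  · exact Or.inl ⟨hC.1, h⟩

theorem flip (hE : IsCutSystem E) (ho : IsOrientation E o) (hC : C ∈ o)
    (hmin : ∀ D ∈ o, D ⊆ C → D = C) : IsOrientation E (insert Cᶜ (o \ {C})) where
  subset := by
    rintro D (rfl | h)
    · exact hE.compl_mem C (ho.subset hC)
    · exact ho.subset h.1
  mem_or := fun D hD => by
    by_cases h : D = C
    · subst h
      exact Or.inr (Or.inl rfl)
    · rcases ho.mem_or D hD with h₁ | h₁
      · exact Or.inl (Or.inr ⟨h₁, h⟩)
      · by_cases h₂ : Dᶜ = C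
        · exact Or.inl (Or.inl (by rw [← h₂, compl_compl]))
        · exact Or.inr (Or.inr ⟨h₁, h₂⟩)
  notMem := by
    rintro D (rfl | h) (h' | h')
    · rw [compl_compl] at h'
      exact ho.notMem C hC (h' ▸ hC)
    · rw [compl_compl] at h'
      exact h'.2 rfl
    · exact h.2 (compl_injective h')
    · exact ho.notMem D h.1 h'.1
  mono := by
    rintro X hX Y hY hXY
    by_cases h : Y = C
    · subst h
      rcases hX with rfl | hX
      · obtain ⟨x, hx⟩ := hE.nonempty _ (hE.compl_mem _ (ho.subset hC))
        exact absurd (hXY hx) hx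
      · exact absurd (hmin X hX.1 hXY) hX.2
    · rcases hX with rfl | hX
      · by_cases h' : Y ∈ o
        · exact Or.inr ⟨h', h⟩
        · refine Or.inl ?_
          rw [← hmin _ (ho.compl_mem hY h') (Set.compl_subset_comm.1 hXY), compl_compl]
      · exact Or.inr ⟨ho.mono X hX.1 Y hY hXY, h⟩
  finite := fun a => ((ho.finite a).insert Cᶜ).subset (by
    rintro D ⟨rfl | h, h'⟩
    · exact Set.mem_insert _ _
    · exact Set.mem_insert_of_mem _ ⟨h.1, h'⟩)

theorem eq_of_sdiff_eq_singleton (hE : IsCutSystem E) {p p' : Set (Set V)}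
    (ho : IsOrientation E o) (hp : IsOrientation E p) (ho' : IsOrientation E o')
    (hp' : IsOrientation E p') (h : o \ p = {C}) (h' : o' \ p' = {C}) : o = o' := by
  have key : ∀ {o p o' p' : Set (Set V)}, IsOrientation E o → IsOrientation E p →
      IsOrientation E o' → IsOrientation E p' → o \ p = {C} → o' \ p' = {C} → o ⊆ o' := by
    intro o p o' p' ho hp ho' hp' h h' D hD
    have hC : C ∈ o \ p := h ▸ rfl
    have hC' : C ∈ o' \ p' := h' ▸ rfl
    by_contra hDo'
    have hDE := ho.subset hD
    have hD' := ho'.compl_mem hDE hDo'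
    have hDp : D ∈ p := by
      by_contra hDp
      have : D ∈ o \ p := ⟨hD, hDp⟩
      rw [h, Set.mem_singleton_iff] at this
      exact hDo' (this ▸ hC'.1)
    have hDp' : Dᶜ ∈ p' := by
      by_contra hDp'
      have : Dᶜ ∈ o' \ p' := ⟨hD', hDp'⟩
      rw [h', Set.mem_singleton_iff] at this
      exact ho.notMem D hD (this ▸ hC.1)
    have hCE := ho.subset hC.1
    rcases hE.nested C hCE D hDE with hn | hn | hn | hn
    · exact hDo' (ho'.mono C hC'.1 D hDE hn)
    · exact hC.2 (hp.mono D hDp C hCE hn)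
    · exact ho.notMem D hD (ho.mono C hC.1 _ (hE.compl_mem D hDE) hn)
    · have := hp'.mono _ (hp'.compl_mem hCE hC'.2) D hDE hn
      exact hp'.notMem D this hDp'
  exact (key ho hp ho' hp' h h').antisymm (key ho' hp' ho hp h' h)

end IsOrientation

/-- The graph of orientations of a cut system; adjacent orientations differ in a single cut. -/
def orientationGraph {V : Type*} (E : Set (Set V)) : SimpleGraph {o // IsOrientation E o} where
  Adj o p := ∃ C, o.1 \ p.1 = {C}
  symm := ⟨by
    rintro o p ⟨C, hC⟩
    exact ⟨Cᶜ, by rw [o.2.sdiff_eq_compl p.2, hC, Set.image_singleton]⟩⟩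
  loopless := ⟨by
    rintro o ⟨C, hC⟩
    rw [sdiff_self] at hC
    exact Set.singleton_ne_empty C hC.symm⟩

theorem orientationGraph_isTree {V : Type*} [Nonempty V] {E : Set (Set V)} (hE : IsCutSystem E) :
    (orientationGraph E).IsTree := by
  have hreach : ∀ n (o p : {o // IsOrientation E o}), (o.1 \ p.1).ncard = n →
      (orientationGraph E).Reachable o p := by
    intro n
    induction n with
    | zero =>
      intro o p h
      have hop := o.2.sdiff_finite p.2
      have hpo := p.2.sdiff_eq_compl o.2
      rw [Set.ncard_eq_zero hop] at h
      have h' : p.1 \ o.1 = ∅ := by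
        rw [o.2.sdiff_eq_compl p.2, h, Set.image_empty]
      rw [Set.sdiff_eq_empty] at h h'
      rw [Subtype.ext (h.antisymm h')]
    | succ n ih =>
      intro o p h
      have hop := o.2.sdiff_finite p.2
      obtain ⟨C, hC, hmin⟩ := hop.exists_minimal (Set.nonempty_of_ncard_ne_zero (by omega))
      have hmin' : ∀ D ∈ o.1, D ⊆ C → D = C := by
        intro D hD hDC
        have hDp : D ∉ p.1 := fun h => hC.2 (p.2.mono D h C (o.2.subset hC.1) hDC)
        exact hDC.antisymm (hmin ⟨hD, hDp⟩ hDC)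
      let q : {o // IsOrientation E o} := ⟨_, o.2.flip hE hC.1 hmin'⟩
      have hCc : Cᶜ ∉ o.1 := o.2.notMem C hC.1
      have hCp : Cᶜ ∈ p.1 := p.2.compl_mem (o.2.subset hC.1) hC.2
      have hadj : (orientationGraph E).Adj o q := by
        refine ⟨C, ?_⟩
        ext D
        have hne : C ≠ Cᶜ := fun h => hCc (h ▸ hC.1)
        simp only [q, Set.mem_sdiff, Set.mem_insert_iff, Set.mem_singleton_iff]
        constructor
        · rintro ⟨h₁, h₂⟩
          by_contra h₃
          exact h₂ (Or.inr ⟨h₁, h₃⟩)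
        · rintro rfl
          exact ⟨hC.1, by simp [hne]⟩
      refine hadj.reachable.trans (ih q p ?_)
      have : q.1 \ p.1 = (o.1 \ p.1) \ {C} := by
        ext D
        simp only [q, Set.mem_sdiff, Set.mem_insert_iff, Set.mem_singleton_iff]
        constructor
        · rintro ⟨rfl | h₁, h₂⟩
          · exact absurd hCp h₂
          · exact ⟨⟨h₁.1, h₂⟩, h₁.2⟩
        · rintro ⟨⟨h₁, h₂⟩, h₃⟩
          exact ⟨Or.inr ⟨h₁, h₃⟩, h₂⟩
      rw [this, Set.ncard_sdiff_singleton_of_mem hC, h]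
      rfl
  have : Nonempty {o // IsOrientation E o} :=
    ⟨⟨_, IsOrientation.of_point hE (Classical.arbitrary V)⟩⟩
  refine ⟨⟨fun o p => hreach _ o p rfl⟩, ?_⟩
  rw [SimpleGraph.isAcyclic_iff_forall_adj_isBridge]
  intro o p hop
  rw [SimpleGraph.isBridge_iff_forall_walk_mem_edges]
  intro w
  obtain ⟨C, hC⟩ := id hop
  have hC' : C ∈ o.1 \ p.1 := hC ▸ rfl
  obtain ⟨d, hd, h₁, h₂⟩ := w.exists_boundary_dart {q | C ∈ q.1} hC'.1 hC'.2
  obtain ⟨D, hD⟩ := id d.adj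
  have hCD : C ∈ d.fst.1 \ d.snd.1 := ⟨h₁, h₂⟩
  have hDC : C = D := by rwa [hD] at hCD
  rw [← hDC] at hD
  have e₁ := IsOrientation.eq_of_sdiff_eq_singleton hE d.fst.2 d.snd.2 o.2 p.2 hD hC
  have e₂ := IsOrientation.eq_of_sdiff_eq_singleton hE d.snd.2 d.fst.2 p.2 o.2 (C := Cᶜ)
    (by rw [d.fst.2.sdiff_eq_compl d.snd.2, hD, Set.image_singleton])
    (by rw [o.2.sdiff_eq_compl p.2, hC, Set.image_singleton])
  have : d.edge ∈ w.edges := List.mem_map_of_mem hd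
  have hde : d.edge = s(o, p) := by
    rw [← Subtype.ext e₁, ← Subtype.ext e₂]
    rfl
  rwa [← hde]

theorem IsOrientation.smul {V H : Type*} [Group H] [MulAction H V] {E : Set (Set V)}
    (hE : ∀ (g : H), ∀ C ∈ E, g • C ∈ E) (g : H) {o : Set (Set V)} (ho : IsOrientation E o) :
    IsOrientation E (g • o) where
  subset := by
    rintro _ ⟨C, hC, rfl⟩
    exact hE g C (ho.subset hC)
  mem_or := fun C hC => by
    rw [Set.mem_smul_set_iff_inv_smul_mem, Set.mem_smul_set_iff_inv_smul_mem, Set.smul_set_compl]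
    exact ho.mem_or _ (hE _ _ hC)
  notMem := fun C hC => by
    rw [Set.mem_smul_set_iff_inv_smul_mem] at hC ⊢
    rw [Set.smul_set_compl]
    exact ho.notMem _ hC
  mono := fun C hC D hD hCD => by
    rw [Set.mem_smul_set_iff_inv_smul_mem] at hC ⊢
    exact ho.mono _ hC _ (hE _ _ hD) (Set.smul_set_mono hCD)
  finite := fun a => ((ho.finite (g⁻¹ • a)).image fun C => g • C).subset (by
    rintro C ⟨hC, ha⟩
    rw [Set.mem_smul_set_iff_inv_smul_mem] at hC
    refine ⟨g⁻¹ • C, ⟨hC, ?_⟩, smul_inv_smul g C⟩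
    rwa [Set.smul_mem_smul_set_iff])

/-- The action of a group on the orientations of an invariant cut system. -/
abbrev orientationAction {V H : Type*} [Group H] [MulAction H V] {E : Set (Set V)}
    (hE : ∀ (g : H), ∀ C ∈ E, g • C ∈ E) : MulAction H {o // IsOrientation E o} where
  smul g o := ⟨g • o.1, o.2.smul hE g⟩
  one_smul o := Subtype.ext (one_smul H o.1)
  mul_smul g h o := Subtype.ext (mul_smul g h o.1)

/-- A subgroup that fixes an orientation is finite unless some cut splits it. -/
theorem IsOrientation.finite_stabilizer {H : Type*} [Group H] {E : Set (Set H)}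
    (hst : ∀ C ∈ E, {k : H | k • C = C}.Finite)
    (hsplit : ∀ K : Subgroup H, (K : Set H).Infinite →
      ∃ C ∈ E, (↑K ∩ C).Infinite ∧ (↑K ∩ Cᶜ).Infinite)
    {o : Set (Set H)} (ho : IsOrientation E o) {K : Subgroup H} (hK : ∀ k ∈ K, k • o = o) :
    (K : Set H).Finite := by
  by_contra hinf
  obtain ⟨C, hCE, h₁, h₂⟩ := hsplit K hinf
  have key : ∀ C ∈ o, (↑K ∩ Cᶜ).Finite := by
    intro C hC
    refine Set.Finite.of_finite_fibers (fun k : H => k⁻¹ • C) ((ho.finite 1).subset ?_) ?_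
    · rintro _ ⟨k, ⟨hk, hkC⟩, rfl⟩
      refine ⟨?_, fun h => hkC ?_⟩
      · rw [← Set.mem_smul_set_iff_inv_smul_mem, hK k hk]
        exact hC
      · simpa [Set.mem_inv_smul_set_iff] using h
    · rintro _ ⟨k₀, -, rfl⟩
      refine ((hst C (ho.subset hC)).preimage
        (f := fun k : H => k₀ * k⁻¹) (fun a _ b _ h => by simpa using h)).subset ?_
      rintro k ⟨-, hk⟩
      have hk' : k⁻¹ • C = k₀⁻¹ • C := hk
      change (k₀ * k⁻¹) • C = C
      rw [mul_smul, hk', smul_inv_smul]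
  rcases ho.mem_or C hCE with h | h
  · exact h₂ (key C h)
  · have := key _ h
    rw [compl_compl] at this
    exact h₁ this

/-- A group acts on a tree with stabilisers of bounded order as soon as each of its infinite
subgroups is split by a cut of bounded size in a fixed locally finite free transitive graph. -/
theorem exists_tree_action {H : Type} [Group H] {G : SimpleGraph H} (hG : G.Preconnected)
    (hadj : ∀ (g : H) u v, G.Adj u v → G.Adj (g • u) (g • v))
    (hloc : ∀ v, {u | G.Adj u v}.Finite) {k : ℕ}
    (hsplit : ∀ K : Subgroup H, (K : Set H).Infinite → ∃ C,
      (G.cutEdges C).Finite ∧ (G.cutEdges C).ncard ≤ k ∧ (↑K ∩ C).Infinite ∧ (↑K ∩ Cᶜ).Infinite) :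
    ∃ (T : Type) (_ : MulAction H T) (𝒯 : SimpleGraph T), 𝒯.IsTree ∧
      (∀ (g : H) u v, 𝒯.Adj u v → 𝒯.Adj (g • u) (g • v)) ∧
      ∃ B : ℕ, ∀ t : T, (MulAction.stabilizer H t : Set H).Finite ∧
        (MulAction.stabilizer H t : Set H).ncard ≤ B := by
  set E := G.optCuts k with hEdef
  have hmin : ∀ C ∈ E, ∃ 𝒰 𝒱, G.IsMinCut k 𝒰 𝒱 C := fun C ⟨𝒰, 𝒱, h⟩ => ⟨𝒰, 𝒱, h.1⟩
  have hcompl : ∀ C ∈ E, Cᶜ ∈ E := fun C h => SimpleGraph.compl_mem_optCuts h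
  have hfincut : ∀ C ∈ E, (G.cutEdges C).Finite := fun C h => by
    obtain ⟨𝒰, 𝒱, h⟩ := hmin C h
    exact h.finite
  have hne : ∀ C ∈ E, C.Nonempty := fun C h => by
    obtain ⟨𝒰, 𝒱, h⟩ := hmin C h
    exact h.nonempty
  have hcutne : ∀ C ∈ E, (G.cutEdges C).Nonempty := fun C h =>
    SimpleGraph.cutEdges_nonempty hG (hne C h) (hne _ (hcompl C h))
  have hlocal : ∀ u v, G.Adj u v → {C ∈ E | u ∈ C ∧ v ∉ C}.Finite := by
    intro u v huv
    refine (SimpleGraph.finite_setOf_connectedSet_cut k G huv).subset ?_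
    rintro C ⟨hC, h₁, h₂⟩
    obtain ⟨𝒰, 𝒱, h⟩ := hmin C hC
    exact ⟨h.connectedSet hG, h.compl.connectedSet hG, h₁, h₂, h.finite, h.le⟩
  have hE : IsCutSystem E := by
    refine ⟨hcompl, hne, fun C hC D hD => SimpleGraph.nested_of_mem_optCuts hG hC hD, ?_⟩
    intro u v
    obtain ⟨p⟩ := hG u v
    refine ((List.finite_toSet p.darts).biUnion fun d _ => hlocal d.fst d.snd d.adj).subset ?_
    rintro C ⟨hC, h₁, h₂⟩
    obtain ⟨d, hd, h₃, h₄⟩ := p.exists_boundary_dart C h₁ h₂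
    exact Set.mem_biUnion hd ⟨hC, h₃, h₄⟩
  have hsmul : ∀ (g : H), ∀ C ∈ E, g • C ∈ E := fun g C h => SimpleGraph.smul_mem_optCuts hadj g h
  have hst : ∀ C ∈ E, {k : H | k • C = C}.Finite := fun C h =>
    (SimpleGraph.ncard_stabilizer_le hadj (fun g h v hgh => by simpa using hgh) (hfincut C h)
      (hcutne C h)).1
  have hsplit' : ∀ K : Subgroup H, (K : Set H).Infinite →
      ∃ C ∈ E, (↑K ∩ C).Infinite ∧ (↑K ∩ Cᶜ).Infinite := by
    intro K hK
    obtain ⟨C, hf, hk, h₁, h₂⟩ := hsplit K hK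
    have hexu : ∀ S : Set H, S.Infinite → ∃ 𝒰 : Ultrafilter H, S ∈ 𝒰 ∧
        ∀ A ∈ 𝒰, A.Infinite := by
      intro S hS
      have := Filter.cofinite_inf_principal_neBot_iff.2 hS
      let 𝒰 := Ultrafilter.of (Filter.cofinite ⊓ Filter.principal S)
      have hle : (𝒰 : Filter H) ≤ Filter.cofinite ⊓ Filter.principal S := Ultrafilter.of_le _
      refine ⟨𝒰, hle (Filter.mem_inf_of_right (Filter.mem_principal_self S)), fun A hA hfin => ?_⟩
      have h := hle (Filter.mem_inf_of_left hfin.compl_mem_cofinite)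
      exact Ultrafilter.compl_mem_iff_notMem.1 h hA
    obtain ⟨𝒰, hU, hU'⟩ := hexu _ h₁
    obtain ⟨𝒱, hV, hV'⟩ := hexu _ h₂
    rw [Ultrafilter.inter_mem_iff] at hU hV
    have hs : 𝒰.SeparatedBy 𝒱 C := fun h =>
      Ultrafilter.compl_mem_iff_notMem.1 hV.2 (h.1 hU.2)
    obtain ⟨D, hD⟩ := SimpleGraph.exists_isOptCut hs hf hk
    refine ⟨D, ⟨𝒰, 𝒱, hD⟩, ?_⟩
    have hsD := hD.1.sep
    by_cases hDU : D ∈ 𝒰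
    · have hDV : D ∉ 𝒱 := fun h => hsD ⟨fun _ => h, fun _ => hDU⟩
      exact ⟨hU' _ (Ultrafilter.inter_mem_iff.2 ⟨hU.1, hDU⟩),
        hV' _ (Ultrafilter.inter_mem_iff.2 ⟨hV.1, Ultrafilter.compl_mem_iff_notMem.2 hDV⟩)⟩
    · have hDV : D ∈ 𝒱 := by_contra fun h => hsD ⟨fun h' => absurd h' hDU, fun h' => absurd h' h⟩
      exact ⟨hV' _ (Ultrafilter.inter_mem_iff.2 ⟨hV.1, hDV⟩),
        hU' _ (Ultrafilter.inter_mem_iff.2 ⟨hU.1, Ultrafilter.compl_mem_iff_notMem.2 hDU⟩)⟩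
  let _ := orientationAction hsmul
  have hcoe : ∀ (g : H) (o : {o // IsOrientation E o}), (g • o).1 = g • o.1 := fun _ _ => rfl
  have htree := orientationGraph_isTree hE
  have hact : ∀ (g : H) (u v : {o // IsOrientation E o}), (orientationGraph E).Adj u v →
      (orientationGraph E).Adj (g • u) (g • v) := by
    rintro g u v ⟨C, hC⟩
    exact ⟨g • C, by rw [hcoe, hcoe, ← Set.smul_set_sdiff, hC, Set.smul_set_singleton]⟩
  refine ⟨_, orientationAction hsmul, orientationGraph E, htree, hact, ?_⟩
  have hstab : ∀ t : {o // IsOrientation E o}, (MulAction.stabilizer H t : Set H).Finite :=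
    fun t => t.2.finite_stabilizer hst hsplit' fun k hk => congrArg Subtype.val hk
  let o₁ : {o // IsOrientation E o} := ⟨_, IsOrientation.of_point hE 1⟩
  let 𝒪 : Set {o // IsOrientation E o} :=
    insert o₁ (⋃ v ∈ {v | G.Adj v 1}, ⋃ C ∈ {C ∈ E | (1 : H) ∈ C ∧ v ∉ C},
      {o | ∃ p : {o // IsOrientation E o}, o.1 \ p.1 = {C}})
  have h𝒪 : 𝒪.Finite := by
    refine Set.Finite.insert _ ((hloc 1).biUnion fun v hv =>
      (hlocal 1 v hv.symm).biUnion fun C _ => Set.Subsingleton.finite ?_)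
    rintro o ⟨p, hp⟩ o' ⟨p', hp'⟩
    exact Subtype.ext (IsOrientation.eq_of_sdiff_eq_singleton hE o.2 p.2 o'.2 p'.2 hp hp')
  have hrep : ∀ t : {o // IsOrientation E o}, ∃ g : H, g • t ∈ 𝒪 := by
    intro t
    by_cases ht : t = o₁
    · exact ⟨1, by rw [one_smul, ht]; exact Set.mem_insert _ _⟩
    · obtain ⟨w⟩ := htree.connected t o₁
      cases w with
      | nil => exact absurd rfl ht
      | @cons _ p _ hp _ =>
        obtain ⟨C, hC⟩ := hp
        have hCE : C ∈ E := t.2.subset (hC ▸ rfl : C ∈ t.1 \ p.1).1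
        obtain ⟨⟨u, v⟩, huv, hu, hv⟩ := hcutne C hCE
        refine ⟨u⁻¹, Or.inr (Set.mem_biUnion (x := u⁻¹ • v) ?_
          (Set.mem_biUnion (x := u⁻¹ • C) ⟨hsmul _ _ hCE, ?_, ?_⟩ ⟨u⁻¹ • p, ?_⟩))⟩
        · have := (hadj u⁻¹ _ _ huv).symm
          simpa using this
        · simpa [Set.mem_inv_smul_set_iff] using hu
        · simpa [Set.mem_inv_smul_set_iff] using hv
        · rw [hcoe, hcoe, ← Set.smul_set_sdiff, hC, Set.smul_set_singleton]
  obtain ⟨B, hB⟩ := (h𝒪.image fun t => (MulAction.stabilizer H t : Set H).ncard).bddAbove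
  refine ⟨B, fun t => ⟨hstab t, ?_⟩⟩
  obtain ⟨g, hg⟩ := hrep t
  refine le_trans ?_ (hB ⟨_, hg, rfl⟩)
  refine Set.ncard_le_ncard_of_injOn (fun k => g * k * g⁻¹) (fun k hk => ?_) ?_ (hstab _)
  · have hk' : k • t = t := hk
    change (g * k * g⁻¹) • g • t = g • t
    rw [← mul_smul, inv_mul_cancel_right, mul_smul, hk']
  · intro a _ b _ h
    simpa using h

end PointwiseCuts

/-- A permutation-valued cocycle over a group action whose restriction to each stabiliser is a
free action. -/
structure IsFreeCocycle {H Ω ι : Type*} [Group H] [MulAction H Ω]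
    (c : H → Ω → Equiv.Perm ι) : Prop where
  mul : ∀ g h ω, c (g * h) ω = c g (h • ω) * c h ω
  free : ∀ g ω i, g • ω = ω → c g ω i = i → g = 1

theorem exists_orbit_section (H Ω : Type*) [Group H] [MulAction H Ω] :
    ∃ (r : Ω → Ω) (y : Ω → H), (∀ ω, y ω • r ω = ω) ∧ ∀ (g : H) ω, r (g • ω) = r ω := by
  let r : Ω → Ω := fun ω => (Quotient.mk (MulAction.orbitRel H Ω) ω).out
  have hr : ∀ ω, ∃ g : H, g • r ω = ω := fun ω => by
    obtain ⟨g, hg⟩ := MulAction.orbitRel_apply.1 (Quotient.mk_out (s := MulAction.orbitRel H Ω) ω)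
    exact ⟨g⁻¹, by rw [inv_smul_eq_iff]; exact hg.symm⟩
  choose y hy using hr
  refine ⟨r, y, hy, fun g ω => ?_⟩
  have : Quotient.mk (MulAction.orbitRel H Ω) (g • ω) = Quotient.mk (MulAction.orbitRel H Ω) ω :=
    Quotient.sound (MulAction.orbitRel_apply.2 ⟨g, rfl⟩)
  simp only [r, this]

/-- A finite group acts freely on every finite set whose size is a multiple of its order. -/
theorem exists_free_perm {S : Type*} [Group S] {N : ℕ} [NeZero N] (h : Nat.card S ∣ N) :
    ∃ ρ : S →* Equiv.Perm (Fin N), ∀ s i, ρ s i = i → s = 1 := by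
  obtain ⟨m, rfl⟩ := h
  have hS : Nat.card S ≠ 0 := fun h => NeZero.ne (Nat.card S * m) (by rw [h, zero_mul])
  have : Finite S := Nat.finite_of_card_ne_zero hS
  have e : Fin (Nat.card S * m) ≃ S × Fin m :=
    finProdFinEquiv.symm.trans ((Finite.equivFin S).symm.prodCongr (Equiv.refl _))
  refine ⟨⟨⟨fun s => e.trans (((Equiv.mulLeft s).prodCongr (Equiv.refl _)).trans e.symm), ?_⟩, ?_⟩,
    ?_⟩
  · ext i
    simp
  · intro s t
    ext i
    simp [Prod.map]
  · intro s i hi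
    have := congrArg (fun j => (e j).1) hi
    simpa using this

theorem exists_isFreeCocycle {H Ω : Type*} [Group H] [MulAction H Ω] {N : ℕ} [NeZero N]
    (h : ∀ ω : Ω, Nat.card (MulAction.stabilizer H ω) ∣ N) :
    ∃ c : H → Ω → Equiv.Perm (Fin N), IsFreeCocycle c := by
  obtain ⟨r, y, hy, hr⟩ := exists_orbit_section H Ω
  choose ρ hρ using fun ω : Ω => exists_free_perm (h ω)
  have hmem : ∀ g ω, (y (g • ω))⁻¹ * g * y ω ∈ MulAction.stabilizer H (r ω) := by
    intro g ω
    rw [MulAction.mem_stabilizer_iff, mul_smul, mul_smul, hy, inv_smul_eq_iff, ← hr g ω, hy]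
  refine ⟨fun g ω => ρ (r ω) ⟨_, hmem g ω⟩, ⟨fun g h ω => ?_, fun g ω i hg hi => ?_⟩⟩
  · have key : ∀ (ω' : Ω) (hω' : ω' = r ω) (x : H) (hx : x ∈ MulAction.stabilizer H ω'),
        ρ ω' ⟨x, hx⟩ = ρ (r ω) ⟨x, hω' ▸ hx⟩ := by
      rintro _ rfl x hx
      rfl
    rw [key _ (hr h ω), ← map_mul]
    congr 1
    ext
    simp [mul_smul, mul_assoc]
  · have := congrArg Subtype.val (hρ (r ω) _ i hi)
    simp only [hg, Subgroup.coe_one] at this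
    calc g = y ω * ((y ω)⁻¹ * g * y ω) * (y ω)⁻¹ := by group
      _ = 1 := by rw [this]; group

/-- Free actions of a group on a finite set are conjugate. -/
theorem exists_conj_of_free {S : Type*} [Group S] {N : ℕ} [NeZero N]
    {ρ₁ ρ₂ : S →* Equiv.Perm (Fin N)} (h₁ : ∀ s i, ρ₁ s i = i → s = 1)
    (h₂ : ∀ s i, ρ₂ s i = i → s = 1) :
    ∃ ψ : Equiv.Perm (Fin N), ∀ s, ρ₂ s * ψ = ψ * ρ₁ s := by
  have key : ∀ ρ : S →* Equiv.Perm (Fin N), (∀ s i, ρ s i = i → s = 1) →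
      ∃ (Q : Type) (e : Q × S ≃ Fin N), ∀ s q t, e (q, s * t) = ρ s (e (q, t)) := by
    intro ρ hρ
    let _ : MulAction S (Fin N) := MulAction.compHom _ ρ
    have hact : ∀ s (i : Fin N), s • i = ρ s i := fun _ _ => rfl
    obtain ⟨r, y, hy, hr⟩ := exists_orbit_section S (Fin N)
    have hfree : ∀ (s t : S) (i : Fin N), s • i = t • i → s = t := by
      intro s t i h
      rw [← inv_mul_eq_one]
      refine (hρ _ i ?_)
      rw [← hact, mul_smul, ← h, inv_smul_smul]
    have hrr : ∀ i, r (r i) = r i := fun i => by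
      conv_rhs => rw [← hy i, hr]
    refine ⟨Set.range r, ⟨fun p => p.2 • p.1.1, fun i => (⟨r i, i, rfl⟩, y i), ?_, ?_⟩, ?_⟩
    · rintro ⟨⟨_, i, rfl⟩, s⟩
      have h : r (s • r i) = r i := by rw [hr, hrr]
      refine Prod.ext (Subtype.ext h) (hfree _ _ (r i) ?_)
      have := hy (s • r i)
      rwa [h] at this
    · intro i
      exact hy i
    · intro s q t
      exact mul_smul s t q.1
  obtain ⟨Q₁, e₁, he₁⟩ := key ρ₁ h₁
  obtain ⟨Q₂, e₂, he₂⟩ := key ρ₂ h₂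
  have hc₁ := Nat.card_congr e₁
  have hc₂ := Nat.card_congr e₂
  rw [Nat.card_prod, Nat.card_fin] at hc₁ hc₂
  have hN := NeZero.ne N
  have hQ : Nat.card Q₁ = Nat.card Q₂ :=
    Nat.eq_of_mul_eq_mul_right (Nat.pos_of_ne_zero fun h => hN (by rw [← hc₁, h, mul_zero]))
      (hc₁.trans hc₂.symm)
  have : Finite Q₁ := Nat.finite_of_card_ne_zero fun h => hN (by rw [← hc₁, h, zero_mul])
  have : Finite Q₂ := Nat.finite_of_card_ne_zero fun h => hN (by rw [← hc₂, h, zero_mul])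
  obtain ⟨σ⟩ := Finite.card_eq.1 hQ
  refine ⟨e₁.symm.trans ((σ.prodCongr (Equiv.refl S)).trans e₂), fun s => ?_⟩
  ext1 i
  obtain ⟨⟨q, t⟩, rfl⟩ := e₁.surjective i
  simp [← he₁, ← he₂]

/-- Free cocycles over the same action are cohomologous. -/
theorem IsFreeCocycle.exists_transfer {H Ω : Type*} [Group H] [MulAction H Ω] {N : ℕ} [NeZero N]
    {c₁ c₂ : H → Ω → Equiv.Perm (Fin N)} (h₁ : IsFreeCocycle c₁) (h₂ : IsFreeCocycle c₂) :
    ∃ ψ : Ω → Equiv.Perm (Fin N), ∀ g ω, c₂ g ω * ψ ω = ψ (g • ω) * c₁ g ω := by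
  obtain ⟨r, y, hy, hr⟩ := exists_orbit_section H Ω
  have hhom : ∀ {c : H → Ω → Equiv.Perm (Fin N)}, IsFreeCocycle c → ∀ ω : Ω,
      ∃ ρ : MulAction.stabilizer H ω →* Equiv.Perm (Fin N), (∀ s, ρ s = c s ω) ∧
        ∀ s i, ρ s i = i → s = 1 := by
    intro c hc ω
    refine ⟨MonoidHom.mk' (fun s => c s ω) ?_, fun _ => rfl, ?_⟩
    · intro s t
      rw [Subgroup.coe_mul, hc.mul, t.2]
    · intro s i hi
      exact Subtype.ext (hc.free s ω i s.2 hi)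
  have hψ : ∀ ω : Ω, ∃ ψ : Equiv.Perm (Fin N), ∀ s ∈ MulAction.stabilizer H ω,
      c₂ s ω * ψ = ψ * c₁ s ω := by
    intro ω
    obtain ⟨ρ₁, hρ₁, hf₁⟩ := hhom h₁ ω
    obtain ⟨ρ₂, hρ₂, hf₂⟩ := hhom h₂ ω
    obtain ⟨ψ, hψ⟩ := exists_conj_of_free hf₁ hf₂
    exact ⟨ψ, fun s hs => by simpa [hρ₁, hρ₂] using hψ ⟨s, hs⟩⟩
  choose ψ hψ using hψ
  refine ⟨fun ω => c₂ (y ω) (r ω) * ψ (r ω) * (c₁ (y ω) (r ω))⁻¹, fun g ω => ?_⟩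
  have hs : (y (g • ω))⁻¹ * g * y ω ∈ MulAction.stabilizer H (r ω) := by
    rw [MulAction.mem_stabilizer_iff, mul_smul, mul_smul, hy, inv_smul_eq_iff, ← hr g ω, hy]
  obtain ⟨s, hs, hgs⟩ : ∃ s ∈ MulAction.stabilizer H (r ω), g * y ω = y (g • ω) * s :=
    ⟨_, hs, by group⟩
  have hcoc : ∀ {c : H → Ω → Equiv.Perm (Fin N)}, IsFreeCocycle c →
      c g ω * c (y ω) (r ω) = c (y (g • ω)) (r ω) * c s (r ω) := by
    intro c hc
    have e₁ := hc.mul g (y ω) (r ω)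
    have e₂ := hc.mul (y (g • ω)) s (r ω)
    rw [hy, hgs] at e₁
    rw [MulAction.mem_stabilizer_iff.1 hs] at e₂
    rw [← e₁, e₂]
  have e₁ := hcoc h₁
  have e₂ := hcoc h₂
  have e₃ := hψ (r ω) s hs
  simp only [hr]
  rw [← mul_assoc, ← mul_assoc, e₂, mul_assoc _ (c₂ s _), e₃, mul_inv_eq_iff_eq_mul]
  rw [mul_assoc _ (c₁ g ω), e₁]
  group

namespace SimpleGraph

variable {T : Type*} {G : SimpleGraph T}

/-- The product of the labels along a walk. -/
def Walk.labelProd {M : Type*} [Monoid M] (l : T → T → M) : ∀ {u v : T}, G.Walk u v → M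
  | _, _, .nil => 1
  | u, _, .cons (v := v) _ p => l u v * p.labelProd l

theorem Walk.labelProd_concat {M : Type*} [Monoid M] (l : T → T → M) {u v w : T} (p : G.Walk u v)
    (h : G.Adj v w) : (p.concat h).labelProd l = p.labelProd l * l v w := by
  induction p with
  | nil => simp [Walk.concat, Walk.labelProd]
  | cons h' p ih => simp [Walk.concat_cons, Walk.labelProd, ih, mul_assoc]

/-- On a tree, antisymmetric edge labels have a potential. -/
theorem IsTree.exists_potential {Γ : Type*} [Group Γ] (hG : G.IsTree) {l : T → T → Γ}
    (hl : ∀ u v, G.Adj u v → l u v * l v u = 1) (t : T) :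
    ∃ Φ : T → Γ, (∀ v (p : G.Walk t v), p.IsPath → Φ v = p.labelProd l) ∧
      ∀ u v, G.Adj u v → Φ v = Φ u * l u v := by
  choose p hp hp' using hG.existsUnique_path t
  simp only at hp hp'
  have hmain : ∀ u v (h : G.Adj u v), u ∈ (p v).support →
      (p v).labelProd l = (p u).labelProd l * l u v := by
    intro u v h hu
    rw [hG.isAcyclic.path_concat (hp u) (hp v) h hu, Walk.labelProd_concat]
  refine ⟨fun v => (p v).labelProd l, fun v q hq => by rw [hp' v q hq], fun u v h => ?_⟩
  by_cases hu : u ∈ (p v).support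
  · exact hmain u v h hu
  · have hv := hG.isAcyclic.mem_support_of_ne_mem_support_of_adj_of_isPath (hp u) (hp v) h hu
    simp only [hmain v u h.symm hv, mul_assoc, hl v u h.symm, mul_one]

variable {H : Type*} [Group H] [MulAction H T]

/-- A group acting on a tree with stabilisers of bounded order has a finite-index normal subgroup
that acts freely and without inversions. -/
theorem IsTree.exists_free_subgroup (hG : G.IsTree)
    (hadj : ∀ (g : H) u v, G.Adj u v → G.Adj (g • u) (g • v)) {B : ℕ}
    (hB : ∀ t : T, (MulAction.stabilizer H t : Set H).Finite ∧
      (MulAction.stabilizer H t : Set H).ncard ≤ B) :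
    ∃ K : Subgroup H, K.Normal ∧ K.FiniteIndex ∧ (∀ k ∈ K, ∀ t : T, k • t = t → k = 1) ∧
      ∀ k ∈ K, ∀ u v : T, G.Adj u v → k • u = v → k • v = u → k = 1 := by
  let _ : MulAction H (Sym2 T) :=
    { smul := fun g e => e.map (g • ·)
      one_smul := fun e => by
        change e.map _ = e
        simp
      mul_smul := fun g h e => by
        change e.map _ = (e.map _).map _
        rw [Sym2.map_map]
        congr 1
        ext t
        exact mul_smul g h t }
  have hsym : ∀ (g : H) (u v : T), g • s(u, v) = s(g • u, g • v) := fun _ _ _ => rfl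
  have hBe : ∀ e : Sym2 T, (MulAction.stabilizer H e : Set H).Finite ∧
      (MulAction.stabilizer H e : Set H).ncard ≤ 2 * B := by
    intro e
    induction e using Sym2.ind with | _ u v
    have hcos : {g : H | g • u = v}.Finite ∧ {g : H | g • u = v}.ncard ≤ B := by
      rcases Set.eq_empty_or_nonempty {g : H | g • u = v} with h | ⟨g₀, hg₀⟩
      · simp [h]
      · have hmaps : ∀ g ∈ {g : H | g • u = v}, g₀⁻¹ * g ∈ (MulAction.stabilizer H u : Set H) := by
          intro g hg
          have hg' : g • u = v := hg
          have hg₀' : g₀ • u = v := hg₀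
          change (g₀⁻¹ * g) • u = u
          rw [mul_smul, hg', ← hg₀', inv_smul_smul]
        have hinj : Set.InjOn (fun g : H => g₀⁻¹ * g) {g : H | g • u = v} :=
          fun a _ b _ h => mul_left_cancel h
        exact ⟨Set.Finite.of_injOn hmaps hinj (hB u).1,
          (Set.ncard_le_ncard_of_injOn _ hmaps hinj (hB u).1).trans (hB u).2⟩
    have hsub : (MulAction.stabilizer H s(u, v) : Set H) ⊆
        (MulAction.stabilizer H u : Set H) ∪ {g : H | g • u = v} := by
      intro g hg
      have hg' : g • s(u, v) = s(u, v) := hg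
      rw [hsym, Sym2.eq_iff] at hg'
      rcases hg' with h | h
      · exact Or.inl h.1
      · exact Or.inr h.1
    have hfin := (hB u).1.union hcos.1
    refine ⟨hfin.subset hsub, (Set.ncard_le_ncard hsub hfin).trans
      ((Set.ncard_union_le _ _).trans ?_)⟩
    have := (hB u).2
    omega
  have hdvd : ∀ (S : Subgroup H), (S : Set H).Finite → (S : Set H).ncard ≤ 2 * B →
      Nat.card S ∣ (2 * B).factorial := by
    intro S hf hn
    have : Finite S := hf
    exact Nat.dvd_factorial Nat.card_pos hn
  have : NeZero (2 * B).factorial := ⟨Nat.factorial_ne_zero _⟩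
  generalize (2 * B).factorial = N at hdvd this
  obtain ⟨c, hc⟩ := exists_isFreeCocycle (H := H) (Ω := T) (N := N)
    fun t => hdvd _ (hB t).1 ((hB t).2.trans (by omega))
  obtain ⟨d, hd⟩ := exists_isFreeCocycle (H := H) (Ω := Sym2 T) (N := N)
    fun e => hdvd _ (hBe e).1 (hBe e).2
  have hc' : IsFreeCocycle fun (g : H) (o : T × T) => c g o.1 :=
    ⟨fun g h o => hc.mul g h o.1, fun g o i ho hi => hc.free g o.1 i (congrArg Prod.fst ho) hi⟩
  have hd' : IsFreeCocycle fun (g : H) (o : T × T) => d g s(o.1, o.2) := by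
    refine ⟨fun g h o => hd.mul g h _, fun g o i ho hi => hd.free g _ i ?_ hi⟩
    rw [hsym]
    have h₁ : g • o.1 = o.1 := congrArg Prod.fst ho
    have h₂ : g • o.2 = o.2 := congrArg Prod.snd ho
    rw [h₁, h₂]
  obtain ⟨ψ, hψ⟩ := hc'.exists_transfer hd'
  replace hψ : ∀ (g : H) (u v : T), d g s(u, v) * ψ (u, v) = ψ (g • u, g • v) * c g u :=
    fun g u v => hψ g (u, v)
  have hθ : ∀ (g : H) (u v : T), (ψ (g • v, g • u))⁻¹ * ψ (g • u, g • v) * c g u =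
      c g v * ((ψ (v, u))⁻¹ * ψ (u, v)) := by
    intro g u v
    have h₁ := hψ g u v
    have h₂ := hψ g v u
    rw [Sym2.eq_swap, ← eq_mul_inv_iff_mul_eq] at h₂
    rw [mul_assoc, ← h₁, h₂]
    group
  have ⟨t⟩ := hG.connected.nonempty
  obtain ⟨Φ, -, hΦ⟩ := hG.exists_potential (l := fun u v => (ψ (u, v))⁻¹ * ψ (v, u))
    (fun u v _ => by group) t
  have hindep : ∀ (g : H) (u v : T), Φ (g • v) * c g v * (Φ v)⁻¹ = Φ (g • u) * c g u * (Φ u)⁻¹ := by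
    intro g u v
    obtain ⟨p⟩ := hG.connected v u
    induction p with
    | nil => rfl
    | @cons a b _ h _ ih =>
      rw [← ih, hΦ _ _ (hadj g _ _ h), hΦ _ _ h]
      have := hθ g b a
      have h' : c g b = ((ψ (g • a, g • b))⁻¹ * ψ (g • b, g • a))⁻¹ *
        (c g a * ((ψ (a, b))⁻¹ * ψ (b, a))) := by rw [← this]; group
      rw [h']
      group
  let π : H →* Equiv.Perm (Fin N) := MonoidHom.mk' (fun g => Φ (g • t) * c g t * (Φ t)⁻¹) (by
    intro g h
    rw [hindep g (h • t) t, hc.mul, mul_smul]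
    group)
  have hπ : ∀ g v, π g = Φ (g • v) * c g v * (Φ v)⁻¹ := fun g v => hindep g v t
  have i₀ : Fin N := ⟨0, Nat.pos_of_ne_zero (NeZero.ne N)⟩
  refine ⟨π.ker, inferInstance, inferInstance, ?_, ?_⟩
  · intro k hk v hkv
    rw [MonoidHom.mem_ker, hπ k v, hkv, mul_inv_eq_one, mul_eq_left] at hk
    exact hc.free k v i₀ hkv (by rw [hk]; rfl)
  · intro k hk u v h huv hvu
    rw [MonoidHom.mem_ker, hπ k u, huv, hΦ u v h, mul_inv_eq_one, mul_assoc, mul_eq_left] at hk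
    have h₁ := hψ k u v
    rw [huv, hvu] at h₁
    have h₂ : d k s(u, v) = 1 := by
      rw [← mul_eq_right (b := ψ (u, v)), h₁]
      rw [mul_assoc, inv_mul_eq_one] at hk
      exact hk.symm
    exact hd.free k s(u, v) i₀ (by rw [hsym, huv, hvu, Sym2.eq_swap]) (by rw [h₂]; rfl)

end SimpleGraph

namespace SimpleGraph

variable {T : Type*} {G : SimpleGraph T}

/-- If each edge of a path contributes a letter and the inverse of the letter of its reverse, then
the product of these is trivial only for a closed path. -/
theorem Walk.eq_of_labelProd_eq_one {Q : Type*} {q : T → T → Q}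
    (hrev : ∀ u v, G.Adj u v → q u v ≠ q v u) (hstar : ∀ u v w, q v u = q v w → u = w)
    {u v : T} {p : G.Walk u v} (hp : p.IsPath)
    (h : p.labelProd (fun u v => FreeGroup.of (q u v) * (FreeGroup.of (q v u))⁻¹) = 1) :
    u = v := by
  have main : ∀ {u v : T} (p : G.Walk u v), p.IsPath → ∃ L : List (Q × Bool),
      FreeGroup.IsReduced L ∧
      p.labelProd (fun u v => FreeGroup.of (q u v) * (FreeGroup.of (q v u))⁻¹) = FreeGroup.mk L ∧
      (L = [] → u = v) ∧ ∀ a ∈ L.head?, a = (q u p.snd, true) := by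
    intro u v p hp
    induction p with
    | nil => exact ⟨[], by simp, by simp [Walk.labelProd, FreeGroup.one_eq_mk], by simp, by simp⟩
    | @cons u v w h p ih =>
      obtain ⟨L, hL, hprod, -, hhead⟩ := ih hp.of_cons
      refine ⟨(q u v, true) :: (q v u, false) :: L, ?_, ?_, by simp, by simp⟩
      · rw [FreeGroup.isReduced_cons_cons]
        refine ⟨fun he => absurd he (hrev u v h), ?_⟩
        rw [FreeGroup.IsReduced, List.isChain_cons]
        refine ⟨fun a ha he => ?_, hL⟩
        rw [hhead a ha] at he
        rw [Walk.cons_isPath_iff] at hp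
        exact absurd (hstar _ _ _ he ▸ p.getVert_mem_support 1) hp.2
      · rw [Walk.labelProd, hprod]
        simp only [FreeGroup.of, FreeGroup.inv_mk, FreeGroup.mul_mk]
        rfl
  classical
  obtain ⟨L, hL, hprod, hnil, -⟩ := main p hp
  rw [hprod, FreeGroup.one_eq_mk, ← FreeGroup.toWord_inj, FreeGroup.toWord_mk, FreeGroup.toWord_mk,
    hL.reduce_eq] at h
  exact hnil h

/-- A group acting on a tree freely and without inversions embeds into a free group. -/
theorem IsTree.exists_injective_hom_freeGroup {K : Type*} [Group K] [MulAction K T]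
    (hG : G.IsTree) (hadj : ∀ (g : K) u v, G.Adj u v → G.Adj (g • u) (g • v))
    (hfree : ∀ (k : K) (t : T), k • t = t → k = 1)
    (hinv : ∀ (k : K) (u v : T), G.Adj u v → k • u = v → k • v = u → k = 1) :
    ∃ f : K →* FreeGroup (MulAction.orbitRel.Quotient K (T × T)), Function.Injective f := by
  let q : T → T → MulAction.orbitRel.Quotient K (T × T) := fun u v => Quotient.mk'' (u, v)
  have hq : ∀ u v u' v', q u v = q u' v' ↔ ∃ k : K, k • u' = u ∧ k • v' = v := by
    intro u v u' v'
    rw [Quotient.eq'', MulAction.orbitRel_apply, MulAction.mem_orbit_iff]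
    simp only [Prod.ext_iff]
    rfl
  have hqk : ∀ (k : K) u v, q (k • u) (k • v) = q u v := fun k u v => (hq _ _ _ _).2 ⟨k, rfl, rfl⟩
  have ⟨t⟩ := hG.connected.nonempty
  obtain ⟨Φ, hΦ, hΦadj⟩ := hG.exists_potential
    (l := fun u v => FreeGroup.of (q u v) * (FreeGroup.of (q v u))⁻¹) (fun u v _ => by group) t
  have hΦt : Φ t = 1 := hΦ t .nil (by simp)
  have hconst : ∀ (k : K) {u v} (_ : G.Walk u v), Φ (k • v) * (Φ v)⁻¹ = Φ (k • u) * (Φ u)⁻¹ := by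
    intro k u v p
    induction p with
    | nil => rfl
    | cons h p ih =>
      rw [ih, hΦadj _ _ (hadj k _ _ h), hΦadj _ _ h, hqk, hqk]
      group
  have hmul : ∀ (k : K) v, Φ (k • v) = Φ (k • t) * Φ v := by
    intro k v
    obtain ⟨p⟩ := hG.connected t v
    rw [← mul_inv_eq_iff_eq_mul, hconst k p, hΦt, inv_one, mul_one]
  refine ⟨MonoidHom.mk' (fun k => Φ (k • t)) fun k k' => by rw [mul_smul, hmul], ?_⟩
  rw [injective_iff_map_eq_one]
  intro k hk
  obtain ⟨p, hp, -⟩ := hG.existsUnique_path t (k • t)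
  refine hfree k t (Walk.eq_of_labelProd_eq_one (q := q) ?_ ?_ hp ((hΦ _ p hp).symm.trans hk)).symm
  · intro u v h he
    obtain ⟨k, hk₁, hk₂⟩ := (hq _ _ _ _).1 he
    have := hinv k u v h hk₂ hk₁
    subst this
    rw [one_smul] at hk₁
    exact h.ne hk₁.symm
  · intro u v w he
    obtain ⟨k, hk₁, hk₂⟩ := (hq _ _ _ _).1 he
    rw [hfree k v hk₁, one_smul] at hk₂
    exact hk₂.symm

end SimpleGraph

namespace FreeGroup

/-- A free group of countable rank embeds into any non-abelian free group. -/
theorem exists_injective_hom_of_countable {α β : Type*} [Countable β] [Nontrivial α] :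
    ∃ f : FreeGroup β →* FreeGroup α, Function.Injective f := by
  classical
  obtain ⟨a, b, hab⟩ := exists_pair_ne α
  let σ : Multiplicative ℤ →* MulAut (FreeGroup ℤ) :=
    MonoidHom.mk' (fun n => freeGroupCongr (Equiv.addRight n.toAdd)) fun m n => by
      ext x
      induction x using FreeGroup.induction_on <;> simp_all [add_left_comm, add_comm]
  let f : FreeGroup ℤ →* FreeGroup α := lift fun n => of a ^ n * of b * (of a ^ n)⁻¹
  let g : FreeGroup α →* FreeGroup ℤ ⋊[σ] Multiplicative ℤ := lift fun x =>
    if x = a then SemidirectProduct.inr (Multiplicative.ofAdd 1) else SemidirectProduct.inl (of 0)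
  have hgf : g.comp f = SemidirectProduct.inl := by
    ext1 n
    have h₁ : (SemidirectProduct.inr (Multiplicative.ofAdd 1) :
        FreeGroup ℤ ⋊[σ] Multiplicative ℤ) ^ n = SemidirectProduct.inr (Multiplicative.ofAdd n) := by
      rw [← map_zpow, ← ofAdd_zsmul, smul_eq_mul, mul_one]
    have h₂ : of n = σ (Multiplicative.ofAdd n) (of 0) := by simp [σ]
    have h₃ := SemidirectProduct.inl_aut (φ := σ) (Multiplicative.ofAdd n) (of 0)
    rw [← h₂] at h₃
    rw [MonoidHom.comp_apply, h₃]
    simp [f, g, hab.symm, h₁]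
  have hf : Function.Injective f := by
    refine Function.Injective.of_comp (f := g) ?_
    rw [← MonoidHom.coe_comp, hgf]
    exact SemidirectProduct.inl_injective
  obtain ⟨i, hi⟩ := exists_injective_nat β
  exact ⟨f.comp (map fun x => (i x : ℤ)),
    hf.comp (map_injective fun x y h => hi (by exact_mod_cast h))⟩

end FreeGroup

namespace FreeGroup

theorem mul_comm_of_subsingleton {α : Type*} [Subsingleton α] (x y : FreeGroup α) :
    x * y = y * x := by
  change Commute x y
  induction x using FreeGroup.induction_on with
  | C1 => exact .one_left y
  | of a =>
    induction y using FreeGroup.induction_on with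
    | C1 => exact .one_right _
    | of b => rw [Subsingleton.elim a b]
    | inv_of b h => exact h.inv_right
    | mul y z hy hz => exact hy.mul_right hz
  | inv_of a h => exact h.inv_left
  | mul x z hx hz => exact hx.mul_left hz

/-- The elements `y ^ 4 ^ n * x ^ n` have pairwise non-commuting successive quotients, as they act
on `ℚ` by `t ↦ 2 ^ n * t + 4 ^ n`. -/
theorem not_commute_of_ne {β : Type*} {x y : β} (hxy : x ≠ y) {i j k : ℕ} (hij : i < j)
    (hjk : j < k) {c : ℕ → FreeGroup β} (hc : ∀ n, c n = of y ^ 4 ^ n * of x ^ n) :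
    ¬ Commute ((c i)⁻¹ * c j) ((c j)⁻¹ * c k) := by
  classical
  intro h
  let ρ : FreeGroup β →* Equiv.Perm ℚ := lift fun z =>
    if z = x then Equiv.mulLeft₀ 2 two_ne_zero else Equiv.addRight 1
  have hx : ∀ (n : ℕ) t, ((Equiv.mulLeft₀ (2 : ℚ) two_ne_zero) ^ n) t = 2 ^ n * t := by
    intro n t
    induction n generalizing t with
    | zero => simp
    | succ n ih => rw [pow_succ, Equiv.Perm.mul_apply, ih, pow_succ, mul_assoc]; rfl
  have hρ : ∀ n t, ρ (c n) t = 2 ^ n * t + (2 ^ n) ^ 2 := by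
    intro n t
    have h4 : ((2 : ℚ) ^ n) ^ 2 = 4 ^ n := by rw [← pow_mul, mul_comm, pow_mul]; norm_num
    simp [ρ, hc, hxy.symm, hx, Equiv.Perm.mul_apply, h4]
  have h' : c j * (c i)⁻¹ * c k = c k * (c i)⁻¹ * c j := by
    have := h.eq
    calc c j * (c i)⁻¹ * c k = c j * ((c i)⁻¹ * c j * ((c j)⁻¹ * c k)) := by group
      _ = c k * (c i)⁻¹ * c j := by rw [this]; group
  have h₀ := congrArg (fun g => (ρ g : Equiv.Perm ℚ) 0) h'
  simp only [MonoidHom.map_mul, MonoidHom.map_inv, Equiv.Perm.mul_apply, hρ] at h₀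
  have hu : ∀ s, 2 ^ i * (ρ (c i))⁻¹ s + (2 ^ i) ^ 2 = s := fun s => by
    rw [← hρ]
    exact (ρ (c i)).apply_symm_apply s
  have hk := hu (2 ^ k * 0 + (2 ^ k) ^ 2)
  have hj := hu (2 ^ j * 0 + (2 ^ j) ^ 2)
  have hlt₁ : (2 : ℚ) ^ i < 2 ^ j := pow_lt_pow_right₀ one_lt_two hij
  have hlt₂ : (2 : ℚ) ^ j < 2 ^ k := pow_lt_pow_right₀ one_lt_two hjk
  have : ((2 : ℚ) ^ k - 2 ^ j) * ((2 ^ j - 2 ^ i) * (2 ^ k - 2 ^ i)) = 0 := by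
    linear_combination 2 ^ i * h₀ - 2 ^ j * hk + 2 ^ k * hj
  have hpos : ((2 : ℚ) ^ k - 2 ^ j) * ((2 ^ j - 2 ^ i) * (2 ^ k - 2 ^ i)) ≠ 0 :=
    mul_ne_zero (by linarith) (mul_ne_zero (by linarith) (by linarith))
  exact hpos this

end FreeGroup

section VirtuallyFree

variable {H X : Type} [Group H] {φ : X → H}

theorem exists_injective_hom_of_wordProblem {α : Type} [Countable H]
    (hgen : ∀ h : H, ∃ w, wordVal φ w = h) {A : MAutomaton (FreeGroup α) X}
    (hA : A.Lang = wordProblem φ) (K : Subgroup H) [IsFreeGroup K] :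
    ∃ f : K →* FreeGroup α, Function.Injective f := by
  classical
  obtain ⟨e⟩ : Nonempty (K ≃* FreeGroup (IsFreeGroup.Generators K)) := ⟨IsFreeGroup.toFreeGroup K⟩
  suffices h : ∃ f : FreeGroup (IsFreeGroup.Generators K) →* FreeGroup α, Function.Injective f by
    obtain ⟨f, hf⟩ := h
    exact ⟨f.comp e.toMonoidHom, hf.comp e.injective⟩
  generalize IsFreeGroup.Generators K = β at e
  have hβ : Countable β :=
    Function.Injective.countable (e.symm.injective.comp FreeGroup.of_injective)
  rcases subsingleton_or_nontrivial α with hα | hα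
  swap
  · exact FreeGroup.exists_injective_hom_of_countable
  obtain ⟨Q, _, P, i, T, -, hP, hT, -⟩ := A.exists_pathSystem
  have hT' : ∀ w, wordVal φ w = 1 ↔ ∃ t ∈ T, P i 1 w t := fun w => by
    rw [← hT, hA]
    rfl
  suffices h : ∃ f : β → α, Function.Injective f by
    obtain ⟨f, hf⟩ := h
    exact ⟨FreeGroup.map f, FreeGroup.map_injective hf⟩
  have hβ' : Subsingleton β := by
    refine ⟨fun x y => by_contra fun hxy => ?_⟩
    let c : ℕ → FreeGroup β := fun n => FreeGroup.of y ^ 4 ^ n * FreeGroup.of x ^ n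
    obtain ⟨i, j, k, hij, hjk, hc⟩ := exists_commute_of_comm hgen hP
      FreeGroup.mul_comm_of_subsingleton hT' fun n => (e.symm (c n) : H)
    refine FreeGroup.not_commute_of_ne hxy hij hjk (c := c) (fun _ => rfl) ?_
    refine Commute.of_map (f := e.symm) e.symm.injective ?_
    refine Commute.of_map (f := K.subtype) K.subtype_injective ?_
    simpa using hc
  rcases isEmpty_or_nonempty α with hα' | ⟨⟨a⟩⟩
  · rcases isEmpty_or_nonempty β with hβ'' | hβ''
    · exact ⟨isEmptyElim, fun x => isEmptyElim x⟩
    · have := finite_of_subsingleton hgen hP hT'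
      have := Finite.of_equiv K e.toEquiv
      exact (not_finite (FreeGroup β)).elim
  · exact ⟨fun _ => a, fun _ _ _ => Subsingleton.elim _ _⟩

/-- If a finite-index subgroup of `H` embeds into `M`, then the word problem of `H` is accepted by
a deterministic `M`-automaton, whose states are the cosets of the subgroup. -/
theorem exists_detMAutomaton_of_injective {M : Type} [Group M] (K : Subgroup H) [K.Normal]
    [K.FiniteIndex] {η : K →* M} (hη : Function.Injective η) :
    ∃ B : DetMAutomaton M X, B.Lang = wordProblem φ := by
  let τ : H ⧸ K → H := fun q => q.out * (Quotient.out (1 : H ⧸ K))⁻¹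
  have hτ : ∀ q, (τ q : H ⧸ K) = q := fun q => by simp [τ]
  have hτ₁ : τ 1 = 1 := by simp [τ]
  have hmem : ∀ (q : H ⧸ K) (h : H), τ q * h * (τ (q * h))⁻¹ ∈ K := fun q h => by
    rw [← QuotientGroup.eq_one_iff]
    simp [hτ]
  let l : H ⧸ K → H → M := fun q h => η ⟨_, hmem q h⟩
  have hl : ∀ q g h, l q g * l (q * g) h = l q (g * h) := by
    intro q g h
    rw [← map_mul]
    congr 1
    ext
    simp [mul_assoc]
  have hl₁ : ∀ q, l q 1 = 1 := fun q =>
    (congrArg η (Subtype.ext (by simp))).trans (map_one η)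
  have := Fintype.ofFinite (H ⧸ K)
  let B : DetMAutomaton M X :=
    { State := H ⧸ K
      init := 1
      terminal := {1}
      edge := fun p e q => q = p * φ e.2 ∧ e.1 = l p (φ e.2)
      det := fun p x g h q r h₁ h₂ => ⟨h₁.2.trans h₂.2.symm, h₁.1.trans h₂.1.symm⟩ }
  have hcons : ∀ x w, wordVal φ (x :: w) = φ x * wordVal φ w := fun x w => List.prod_cons
  have hB : ∀ {p m w q}, B.Path p m w q ↔
      q = p * ((wordVal φ w : H) : H ⧸ K) ∧ m = l p (wordVal φ w) := by
    intro p m w q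
    constructor
    · intro h
      induction h with
      | nil p => exact ⟨(mul_one p).symm, (hl₁ p).symm⟩
      | @cons p q r g h x w he _ ih =>
        obtain ⟨rfl, he⟩ := he
        obtain ⟨rfl, rfl⟩ := ih
        rw [hcons, ← hl, mul_assoc]
        exact ⟨rfl, congrArg (· * _) he⟩
    · rintro ⟨rfl, rfl⟩
      induction w generalizing p with
      | nil =>
        have h := DetMAutomaton.Path.nil (A := B) (p * (1 : H ⧸ K))
        rw [← hl₁ p] at h
        nth_rw 1 [mul_one] at h
        exact h
      | cons x w ih =>
        have h := DetMAutomaton.Path.cons (A := B) (p := p) (x := x) (g := l p (φ x)) ⟨rfl, rfl⟩ ih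
        rw [hl, mul_assoc] at h
        rwa [hcons]
  refine ⟨B, Set.ext fun w => ?_⟩
  have h₁ : w ∈ B.Lang ↔ ∃ q ∈ ({1} : Set (H ⧸ K)), B.Path 1 1 w q := Iff.rfl
  rw [h₁]
  simp only [Set.mem_singleton_iff, exists_eq_left, hB, one_mul]
  constructor
  · rintro ⟨h₁, h₂⟩
    have := hη (h₂.symm.trans (map_one η).symm)
    rw [Subtype.ext_iff] at this
    change wordVal φ w = 1
    simpa [hτ₁, ← h₁] using this
  · intro h
    have h' : wordVal φ w = 1 := h
    rw [h', hl₁]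
    exact ⟨rfl, rfl⟩

/-- A group whose word problem is accepted by an automaton over a free group of finite rank is
virtually free. -/
theorem exists_normal_finiteIndex_isFreeGroup [Fintype X]
    {α : Type} [Finite α] (hgen : ∀ h : H, ∃ w, wordVal φ w = h) {A : MAutomaton (FreeGroup α) X}
    (hA : A.Lang = wordProblem φ) : ∃ K : Subgroup H, K.Normal ∧ K.FiniteIndex ∧ IsFreeGroup K := by
  obtain ⟨N, hN⟩ := exists_bottleneck_walk hgen (exists_bottleneck hgen hA)
  obtain ⟨k, hk⟩ := exists_splitting hgen hN
  obtain ⟨T, _, G, hG, hadj, B, hB⟩ := exists_tree_action (cayleyGraph_preconnected hgen)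
    cayleyGraph_adj_smul finite_cayleyGraph_adj hk
  obtain ⟨K, hK, hK', hfree, hinv⟩ := hG.exists_free_subgroup hadj hB
  obtain ⟨f, hf⟩ := hG.exists_injective_hom_freeGroup (K := K) (fun g => hadj g)
    (fun k t h => Subtype.ext (hfree k k.2 t h))
    (fun k u v h h₁ h₂ => Subtype.ext (hinv k k.2 u v h h₁ h₂))
  exact ⟨K, hK, hK', .ofMulEquiv (MonoidHom.ofInjective hf).symm⟩

end VirtuallyFree

/-- A group word problem accepted by a free group automaton is always accepted by a
deterministic free group automaton: if `F` is a finitely generated free group and the word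
problem of `H` (generated as a monoid by the finite set `X`) is accepted by some
`F`-automaton, then it is accepted by a deterministic `F`-automaton. -/
theorem wordProblem_det_free_group_automaton_of_automaton
    {F : Type} [Group F] [IsFreeGroup F] (hFG : Group.FG F)
    {H : Type} [Group H] {X : Type} [Fintype X] (φ : X → H)
    (hgen : ∀ h : H, ∃ w : List X, (w.map φ).prod = h)
    (hacc : ∃ A : MAutomaton F X, A.Lang = wordProblem φ) :
    ∃ B : DetMAutomaton F X, B.Lang = wordProblem φ := by
  obtain ⟨A, hA⟩ := hacc
  let e := IsFreeGroup.toFreeGroup F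
  have : Finite (IsFreeGroup.Generators F) :=
    FreeGroup.finite_of_fg (Group.fg_of_surjective (f := e.toMonoidHom) e.surjective)
  have hA' : (A.mapLabel e).Lang = wordProblem φ := (A.lang_mapLabel e).trans hA
  have : Countable H := Function.Surjective.countable hgen
  obtain ⟨K, _, _, _⟩ := exists_normal_finiteIndex_isFreeGroup hgen hA'
  obtain ⟨f, hf⟩ := exists_injective_hom_of_wordProblem hgen hA' K
  exact exists_detMAutomaton_of_injective K (η := e.symm.toMonoidHom.comp f)
    (e.symm.injective.comp hf)
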